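/- arXiv:2109.03590 — 11 statements merged into one kernel-verified Lean document; each statement's English description precedes it below -/
import Mathlib

section
/- As γ → 1⁺, the rescaled Barenblatt profile converges uniformly on ℝ to a Gaussian: sup_{ξ ∈ ℝ} |𝓑_γ(ξ) − (λ/(2√π)) e^{−ξ²/4}| → 0 as γ → 1⁺. -/
open Real Filter Topology Set

/-- `B(γ) = (γ−1)/(2γ(γ+1))`. -/
noncomputable def Bcoef (γ : ℝ) : ℝ := (γ - 1) / (2 * γ * (γ + 1))

/-- Wallis-type integral `W(γ) = ∫_0^{π/2} (cos θ)^{(γ+1)/(γ−1)} dθ`. -/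
noncomputable def Wint (γ : ℝ) : ℝ := ∫ θ in (0:ℝ)..(π / 2), Real.cos θ ^ ((γ + 1) / (γ - 1))

/-- `A(γ) = (λ B(γ)^{1/2} / (2 W(γ)))^{2(γ−1)/(γ+1)}`. -/
noncomputable def Acoef (lam γ : ℝ) : ℝ :=
  (lam * Bcoef γ ^ ((1:ℝ) / 2) / (2 * Wint γ)) ^ (2 * (γ - 1) / (γ + 1))

/-- Rescaled Barenblatt profile `𝓑_γ(ξ) = (max(A(γ) − B(γ)ξ², 0))^{1/(γ−1)}`. -/
noncomputable def Bprof (lam γ ξ : ℝ) : ℝ :=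
  max (Acoef lam γ - Bcoef γ * ξ ^ 2) 0 ^ ((1:ℝ) / (γ - 1))

open MeasureTheory in
lemma aux_wallis : Tendsto (fun p : ℝ => √p * ∫ θ in (0:ℝ)..(π / 2), Real.cos θ ^ p) atTop
    (𝓝 (√(2 * π) / 2)) := by
  have h1 : ∀ p : ℝ, 0 < p → ∫ t, (Ioc 0 (√p * (π / 2))).indicator
      (fun t => Real.cos (t / √p) ^ p) t = √p * ∫ θ in (0:ℝ)..(π / 2), Real.cos θ ^ p := by
    intro p hp
    have hs : 0 < √p := Real.sqrt_pos.2 hp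
    rw [integral_indicator measurableSet_Ioc, ← intervalIntegral.integral_of_le (by positivity),
      intervalIntegral.integral_comp_div (fun x => Real.cos x ^ p) hs.ne']
    rw [zero_div, mul_div_cancel_left₀ _ hs.ne', smul_eq_mul]
  have h2 : ∫ t, (Ioi (0:ℝ)).indicator (fun t => Real.exp (-(1/2) * t ^ 2)) t = √(2 * π) / 2 := by
    rw [integral_indicator measurableSet_Ioi, integral_gaussian_Ioi]
    congr 2; ring
  rw [← h2]
  refine Tendsto.congr' ((eventually_gt_atTop 0).mono h1) ?_
  refine tendsto_integral_filter_of_dominated_convergence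
    (fun t => Real.exp (-(2 / π ^ 2) * t ^ 2)) ?_ ?_ ?_ ?_
  · filter_upwards with p
    refine AEStronglyMeasurable.indicator ?_ measurableSet_Ioc
    exact Measurable.aestronglyMeasurable (by fun_prop)
  · filter_upwards [eventually_gt_atTop 0] with p hp
    filter_upwards with t
    have hs : 0 < √p := Real.sqrt_pos.2 hp
    by_cases ht : t ∈ Ioc 0 (√p * (π / 2))
    · rw [indicator_of_mem ht]
      have hx0 : 0 < t / √p := div_pos ht.1 hs
      have hx1 : t / √p ≤ π / 2 := by rw [div_le_iff₀ hs]; linarith [ht.2]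
      have hc : 0 ≤ Real.cos (t / √p) := Real.cos_nonneg_of_mem_Icc ⟨by linarith [pi_pos], hx1⟩
      rw [Real.norm_of_nonneg (by positivity)]
      have hb : Real.cos (t / √p) ≤ Real.exp (-(2 / π ^ 2) * (t / √p) ^ 2) := by
        have := Real.cos_le_one_sub_mul_cos_sq (x := t / √p)
          (by rw [abs_of_pos hx0]; linarith [pi_pos])
        have := Real.add_one_le_exp (-(2 / π ^ 2) * (t / √p) ^ 2)
        linarith
      refine (Real.rpow_le_rpow hc hb hp.le).trans (le_of_eq ?_)
      rw [← Real.exp_mul, div_pow, Real.sq_sqrt hp.le]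
      congr 1; field_simp
    · rw [indicator_of_notMem ht, norm_zero]; positivity
  · exact integrable_exp_neg_mul_sq (by positivity)
  · filter_upwards with t
    by_cases ht : 0 < t
    · rw [indicator_of_mem (mem_Ioi.2 ht)]
      have hinf : Tendsto (fun p : ℝ => √p * (π / 2)) atTop atTop :=
        Tendsto.atTop_mul_const (by positivity) Real.tendsto_sqrt_atTop
      have hcongr : ∀ᶠ p : ℝ in atTop, (1 + (Real.cos (t / √p) - 1)) ^ p =
          (Ioc 0 (√p * (π / 2))).indicator (fun t => Real.cos (t / √p) ^ p) t := by
        filter_upwards [hinf.eventually_ge_atTop t] with p hp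
        rw [indicator_of_mem (show t ∈ Ioc 0 (√p * (π / 2)) from ⟨ht, hp⟩)]
        congr 1; ring
      refine Tendsto.congr' hcongr ?_
      apply Real.tendsto_one_add_rpow_exp_of_tendsto
      -- squeeze
      have hz : Tendsto (fun p : ℝ => t / √p) atTop (𝓝 0) :=
        tendsto_const_nhds.div_atTop Real.tendsto_sqrt_atTop
      have hlow : ∀ᶠ p : ℝ in atTop, -(1/2) * t ^ 2 ≤ p * (Real.cos (t / √p) - 1) := by
        filter_upwards [eventually_gt_atTop 0] with p hp
        have h := Real.one_sub_sq_div_two_le_cos (x := t / √p)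
        rw [div_pow, Real.sq_sqrt hp.le] at h
        have : p * (-(t ^ 2 / p / 2)) ≤ p * (Real.cos (t / √p) - 1) :=
          mul_le_mul_of_nonneg_left (by linarith) hp.le
        have e : p * (-(t ^ 2 / p / 2)) = -(1/2) * t ^ 2 := by field_simp
        linarith
      have hup : ∀ᶠ p : ℝ in atTop, p * (Real.cos (t / √p) - 1) ≤
          -(1/2) * t ^ 2 + t ^ 4 * (5 / 96) / p := by
        filter_upwards [eventually_gt_atTop 0, hz.eventually (ge_mem_nhds zero_lt_one)] with p hp h1
        have hs : 0 < √p := Real.sqrt_pos.2 hp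
        have h := Real.cos_bound (x := t / √p) (by rw [abs_of_pos (div_pos ht hs)]; exact h1)
        have h := (abs_le.1 h).2
        have e4 : |t / √p| ^ 4 = t ^ 4 / p ^ 2 := by
          rw [abs_of_pos (div_pos ht hs), div_pow, show √p ^ 4 = (√p ^ 2) ^ 2 by ring,
            Real.sq_sqrt hp.le]
        rw [e4, div_pow, Real.sq_sqrt hp.le] at h
        have : p * (Real.cos (t / √p) - 1) ≤ p * (-(t ^ 2 / p / 2) + t ^ 4 / p ^ 2 * (5 / 96)) :=
          mul_le_mul_of_nonneg_left (by linarith) hp.le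
        refine this.trans (le_of_eq ?_)
        field_simp
      refine tendsto_of_tendsto_of_tendsto_of_le_of_le' tendsto_const_nhds ?_ hlow hup
      have : Tendsto (fun p : ℝ => t ^ 4 * (5 / 96) / p) atTop (𝓝 0) :=
        tendsto_const_nhds.div_atTop tendsto_id
      have h := this.const_add (-(1/2) * t ^ 2)
      rwa [add_zero] at h
    · rw [indicator_of_notMem (by simpa using ht)]
      refine tendsto_const_nhds.congr fun p => ?_
      rw [indicator_of_notMem (fun h => ht h.1)]

lemma aux_exp1 (s y : ℝ) (hs : 1 ≤ s) (hy : 0 ≤ y) :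
    |max (1 - y / s) 0 ^ s - Real.exp (-y)| ≤ 2 / s := by
  have hs0 : 0 < s := by linarith
  have hE : Real.exp (-(y / s)) ^ s = Real.exp (-y) := by
    rw [← Real.exp_mul]; congr 1; field_simp
  have hup : max (1 - y / s) 0 ^ s ≤ Real.exp (-y) := by
    rw [← hE]
    refine Real.rpow_le_rpow (le_max_right _ _) (max_le ?_ (Real.exp_pos _).le) hs0.le
    linarith [Real.add_one_le_exp (-(y / s))]
  rw [abs_sub_comm, abs_of_nonneg (by linarith)]
  rcases le_or_gt y s with h | h
  · have hu0 : 0 ≤ y / s := by positivity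
    have hu1 : y / s ≤ 1 := (div_le_one hs0).2 h
    rw [max_eq_left (by linarith)]
    have h1 : Real.exp (-(y / s)) * (1 - (y / s) ^ 2) ≤ 1 - y / s := by
      have ha := Real.add_one_le_exp (y / s)
      have hb : Real.exp (-(y / s)) * Real.exp (y / s) = 1 := by rw [← Real.exp_add]; simp
      have hc : Real.exp (-(y / s)) * (y / s + 1) ≤ 1 := by
        exact (mul_le_mul_of_nonneg_left ha (Real.exp_pos _).le).trans hb.le
      calc _ = Real.exp (-(y / s)) * (y / s + 1) * (1 - y / s) := by ring
        _ ≤ 1 * (1 - y / s) := mul_le_mul_of_nonneg_right hc (by linarith)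
        _ = _ := one_mul _
    have hsq : 0 ≤ 1 - (y / s) ^ 2 := by nlinarith
    have h2 := Real.rpow_le_rpow (mul_nonneg (Real.exp_pos _).le hsq) h1 hs0.le
    rw [Real.mul_rpow (Real.exp_pos _).le hsq, hE] at h2
    have h3 := one_add_mul_self_le_rpow_one_add (s := -(y / s) ^ 2) (by linarith) hs
    rw [← sub_eq_add_neg] at h3
    have h4 := mul_le_mul_of_nonneg_left h3 (Real.exp_pos (-y)).le
    have h5 : Real.exp (-y) * y ^ 2 ≤ 2 := by
      have ha := Real.quadratic_le_exp_of_nonneg hy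
      have hb : Real.exp (-y) * Real.exp y = 1 := by rw [← Real.exp_add]; simp
      have hc := mul_le_mul_of_nonneg_left (show y ^ 2 / 2 ≤ Real.exp y by linarith)
        (Real.exp_pos (-y)).le
      linarith
    have h6 : Real.exp (-y) * (1 + s * -(y / s) ^ 2) =
        Real.exp (-y) - Real.exp (-y) * y ^ 2 / s := by
      field_simp
      ring
    have h7 : Real.exp (-y) * y ^ 2 / s ≤ 2 / s := by gcongr
    linarith
  · have h0 : (0:ℝ) ≤ max (1 - y / s) 0 ^ s := by positivity
    have : Real.exp (-y) ≤ 1 / s := by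
      rw [Real.exp_neg, ← one_div]
      apply one_div_le_one_div_of_le hs0
      linarith [Real.add_one_le_exp y]
    have : 1 / s ≤ 2 / s := by gcongr; norm_num
    linarith

lemma aux_exp2 (a b z : ℝ) (ha : 1 / 8 ≤ a) (hab : a ≤ b) (hz : 0 ≤ z) :
    |Real.exp (-(a * z)) - Real.exp (-(b * z))| ≤ 8 * (b - a) := by
  have h0 : Real.exp (-(b * z)) ≤ Real.exp (-(a * z)) := by
    apply Real.exp_le_exp.2; nlinarith
  rw [abs_of_nonneg (by linarith)]
  have e : Real.exp (-(b * z)) = Real.exp (-(a * z)) * Real.exp (-((b - a) * z)) := by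
    rw [← Real.exp_add]; congr 1; ring
  have h1 := Real.add_one_le_exp (-((b - a) * z))
  have h2 := mul_le_mul_of_nonneg_left h1 (Real.exp_pos (-(a * z))).le
  have h3 : Real.exp (-(a * z)) * z ≤ 8 := by
    have hb : Real.exp (-(a * z)) * Real.exp (a * z) = 1 := by rw [← Real.exp_add]; simp
    have hc := mul_le_mul_of_nonneg_left
      (show z / 8 ≤ Real.exp (a * z) by nlinarith [Real.add_one_le_exp (a * z)])
      (Real.exp_pos (-(a * z))).le
    linarith
  have h4 := mul_le_mul_of_nonneg_right h3 (sub_nonneg.2 hab)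
  rw [e]
  linarith

lemma aux_exp3 (a b z : ℝ) (ha : 1 / 8 ≤ a) (hb : 1 / 8 ≤ b) (hz : 0 ≤ z) :
    |Real.exp (-(a * z)) - Real.exp (-(b * z))| ≤ 8 * |a - b| := by
  rcases le_total a b with h | h
  · rw [abs_sub_comm a b, abs_of_nonneg (sub_nonneg.2 h)]
    exact aux_exp2 a b z ha h hz
  · rw [abs_sub_comm, abs_of_nonneg (sub_nonneg.2 h)]
    exact aux_exp2 b a z hb h hz

lemma aux_X (lam : ℝ) : Tendsto (fun γ : ℝ => lam * Bcoef γ ^ ((1:ℝ) / 2) / (2 * Wint γ))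
    (𝓝[>] (1:ℝ)) (𝓝 (lam / (2 * √π))) := by
  have hid : Tendsto (fun γ : ℝ => γ) (𝓝[>] (1:ℝ)) (𝓝 1) := tendsto_nhdsWithin_of_tendsto_nhds tendsto_id
  have hp : Tendsto (fun γ : ℝ => (γ + 1) / (γ - 1)) (𝓝[>] (1:ℝ)) atTop := by
    have h0 : Tendsto (fun γ : ℝ => γ - 1) (𝓝[>] (1:ℝ)) (𝓝[>] 0) := by
      refine tendsto_nhdsWithin_iff.2 ⟨by simpa using hid.sub_const 1, ?_⟩
      filter_upwards [self_mem_nhdsWithin] with γ hγ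
      exact sub_pos.2 (mem_Ioi.1 hγ)
    have := Tendsto.pos_mul_atTop (C := 1 + 1) (by norm_num) (hid.add_const 1)
      (tendsto_inv_nhdsGT_zero.comp h0)
    simpa [div_eq_mul_inv] using this
  have hW := aux_wallis.comp hp
  have hB : Tendsto (fun γ : ℝ => √(1 / (2 * γ))) (𝓝[>] (1:ℝ)) (𝓝 √(1 / (2 * 1))) := by
    refine (Real.continuous_sqrt.tendsto _).comp ?_
    exact tendsto_const_nhds.div (hid.const_mul 2) (by norm_num)
  have hlim := (hB.const_mul lam).div (hW.const_mul 2) (by positivity)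
  have e : lam * √(1 / (2 * 1)) / (2 * (√(2 * π) / 2)) = lam / (2 * √π) := by
    rw [Real.sqrt_mul (by norm_num), mul_one, Real.sqrt_div (by norm_num), Real.sqrt_one]
    have h2 : √2 * √2 = (2:ℝ) := Real.mul_self_sqrt (by norm_num)
    have : 0 < √π := Real.sqrt_pos.2 pi_pos
    have : 0 < √(2:ℝ) := by positivity
    field_simp
    rw [pow_two, h2]
  rw [e] at hlim
  refine hlim.congr' ?_
  filter_upwards [self_mem_nhdsWithin] with γ hγ
  have hγ : 1 < γ := hγ
  have hg : 0 < γ - 1 := by linarith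
  have hpp : 0 < (γ + 1) / (γ - 1) := by positivity
  have e1 : √(1 / (2 * γ)) = √((γ + 1) / (γ - 1)) * √(Bcoef γ) := by
    rw [← Real.sqrt_mul hpp.le]
    congr 1; unfold Bcoef; field_simp
  have hsp : √((γ + 1) / (γ - 1)) ≠ 0 := (Real.sqrt_pos.2 hpp).ne'
  show lam * √(1 / (2 * γ)) / (2 * (√((γ + 1) / (γ - 1)) * Wint γ)) = _
  rw [e1, ← Real.sqrt_eq_rpow, show lam * (√((γ + 1) / (γ - 1)) * √(Bcoef γ)) =
    √((γ + 1) / (γ - 1)) * (lam * √(Bcoef γ)) by ring,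
    show 2 * (√((γ + 1) / (γ - 1)) * Wint γ) = √((γ + 1) / (γ - 1)) * (2 * Wint γ) by ring,
    mul_div_mul_left _ _ hsp]

/-- As `γ → 1⁺`, the rescaled Barenblatt profile converges uniformly on `ℝ` to the
Gaussian `ξ ↦ (λ/(2√π)) e^{−ξ²/4}`. -/
theorem barenblatt_tendstoUniformly_gaussian (lam : ℝ) (hlam : 0 < lam) :
    TendstoUniformly (fun γ ξ => Bprof lam γ ξ)
      (fun ξ => lam / (2 * Real.sqrt π) * Real.exp (-ξ ^ 2 / 4)) (𝓝[>] (1:ℝ)) := by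
  set K0 := lam / (2 * √π) with hK0
  have hK0pos : 0 < K0 := by positivity
  have hid : Tendsto (fun γ : ℝ => γ) (𝓝[>] (1:ℝ)) (𝓝 1) := tendsto_nhdsWithin_of_tendsto_nhds tendsto_id
  have hX := aux_X lam
  rw [← hK0] at hX
  have hXpos := hX.eventually (lt_mem_nhds hK0pos)
  have hA : Tendsto (fun γ => Acoef lam γ) (𝓝[>] (1:ℝ)) (𝓝 1) := by
    have h : Tendsto (fun γ : ℝ => 2 * (γ - 1) / (γ + 1)) (𝓝[>] (1:ℝ)) (𝓝 0) := by
      have := ((hid.sub_const 1).const_mul 2).div (hid.add_const 1) (by norm_num)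
      rw [sub_self, mul_zero, zero_div] at this
      exact this
    simpa [Acoef] using hX.rpow h (Or.inl hK0pos.ne')
  have hK : Tendsto (fun γ => Acoef lam γ ^ (1 / (γ - 1))) (𝓝[>] (1:ℝ)) (𝓝 K0) := by
    have h : Tendsto (fun γ : ℝ => 2 / (γ + 1)) (𝓝[>] (1:ℝ)) (𝓝 1) := by
      have := (tendsto_const_nhds (x := (2:ℝ))).div (hid.add_const 1) (by norm_num)
      rw [show (2:ℝ) / (1 + 1) = 1 by norm_num] at this
      exact this
    have h := hX.rpow h (Or.inl hK0pos.ne')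
    rw [Real.rpow_one] at h
    refine h.congr' ?_
    filter_upwards [self_mem_nhdsWithin, hXpos] with γ hγ hx
    have hg : 0 < γ - 1 := sub_pos.2 hγ
    rw [Acoef, ← Real.rpow_mul hx.le]
    congr 1; field_simp
  have hc : Tendsto (fun γ => 1 / (2 * γ * (γ + 1)) / Acoef lam γ) (𝓝[>] (1:ℝ)) (𝓝 (1/4)) := by
    have := ((tendsto_const_nhds (x := (1:ℝ))).div ((hid.const_mul 2).mul (hid.add_const 1))
      (by norm_num)).div hA (by norm_num)
    rw [show (1:ℝ) / (2 * 1 * (1 + 1)) / 1 = 1 / 4 by norm_num] at this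
    exact this
  have hbd : Tendsto (fun γ => Acoef lam γ ^ (1 / (γ - 1)) * (2 * (γ - 1)) +
      Acoef lam γ ^ (1 / (γ - 1)) * (8 * |1 / (2 * γ * (γ + 1)) / Acoef lam γ - 1 / 4|) +
      |Acoef lam γ ^ (1 / (γ - 1)) - K0|) (𝓝[>] (1:ℝ)) (𝓝 0) := by
    have := ((hK.mul ((hid.sub_const 1).const_mul 2)).add
      (hK.mul ((hc.sub_const (1/4)).abs.const_mul 8))).add (hK.sub_const K0).abs
    simpa using this
  rw [Metric.tendstoUniformly_iff]
  intro ε hε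
  filter_upwards [self_mem_nhdsWithin, hbd.eventually (gt_mem_nhds hε),
    hA.eventually (lt_mem_nhds one_pos), hc.eventually (lt_mem_nhds (show (1/8:ℝ) < 1/4 by norm_num)),
    hid.eventually (gt_mem_nhds (show (1:ℝ) < 2 by norm_num))] with γ hγ hb hApos hc8 hγ2 ξ
  have hγ : 1 < γ := hγ
  have hg : 0 < γ - 1 := by linarith
  refine lt_of_le_of_lt ?_ hb
  rw [dist_comm, Real.dist_eq]
  set c := 1 / (2 * γ * (γ + 1)) / Acoef lam γ with hcdef
  set A := Acoef lam γ with hAdef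
  set s := 1 / (γ - 1) with hs
  have hs1 : 1 ≤ s := by rw [hs, le_div_iff₀ hg]; linarith
  have e : Bprof lam γ ξ = A ^ s * max (1 - c * ξ ^ 2 / s) 0 ^ s := by
    rw [Bprof, ← Real.mul_rpow hApos.le (le_max_right _ _), mul_max_of_nonneg _ _ hApos.le, mul_zero]
    congr 2
    rw [← hAdef, hcdef, hs, Bcoef]
    field_simp
  have hKpos : 0 ≤ A ^ s := by positivity
  have hc0 : 0 ≤ c * ξ ^ 2 := by have : 0 < c := by linarith
                                 positivity
  have b1 := aux_exp1 s (c * ξ ^ 2) hs1 hc0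
  have b2 := aux_exp3 c (1/4) (ξ ^ 2) hc8.le (by norm_num) (sq_nonneg _)
  have e2 : (2:ℝ) / s = 2 * (γ - 1) := by rw [hs]; field_simp
  rw [e2] at b1
  have e3 : -ξ ^ 2 / 4 = -(1 / 4 * ξ ^ 2) := by ring
  rw [e, e3]
  set M := max (1 - c * ξ ^ 2 / s) 0 ^ s
  set G := Real.exp (-(1 / 4 * ξ ^ 2))
  set F := Real.exp (-(c * ξ ^ 2))
  have hG0 : 0 < G := Real.exp_pos _
  have hG1 : G ≤ 1 := Real.exp_le_one_iff.2 (by nlinarith [sq_nonneg ξ])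
  calc |A ^ s * M - K0 * G| = |A ^ s * (M - F) + A ^ s * (F - G) + (A ^ s - K0) * G| := by
        congr 1; ring
    _ ≤ |A ^ s * (M - F)| + |A ^ s * (F - G)| + |(A ^ s - K0) * G| := abs_add_three _ _ _
    _ ≤ _ := by
      rw [abs_mul, abs_mul, abs_mul, abs_of_nonneg hKpos, abs_of_pos hG0]
      gcongr
      exact mul_le_of_le_one_right (abs_nonneg _) hG1
end

section
/- The peak value of the rescaled Barenblatt profile converges to the peak value of the limit Gaussian: A(γ)^{1/(γ−1)} → λ/(2√π) as γ → 1⁺. -/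
open Real Filter Topology Set

lemma aux_pointwise (x : ℝ) :
    Tendsto (fun p : ℝ => Real.cos (x / √p) ^ p) atTop (𝓝 (Real.exp (-(1/2) * x ^ 2))) := by
  have h : Tendsto (fun p : ℝ => p * (Real.cos (x / √p) - 1)) atTop (𝓝 (-(1/2) * x ^ 2)) := by
    have h0 : Tendsto (fun p : ℝ => x / √p / 2) atTop (𝓝 0) := by
      have := (tendsto_const_nhds (x := x)).div_atTop Real.tendsto_sqrt_atTop
      simpa using this.div_const 2
    have h1 : Tendsto (fun p : ℝ => Real.sinc (x / √p / 2)) atTop (𝓝 1) := by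
      have := (Real.continuous_sinc.tendsto 0).comp h0
      rw [Real.sinc_zero] at this
      exact this
    have h2 := (h1.pow 2).const_mul (-(1/2) * x ^ 2)
    rw [one_pow, mul_one] at h2
    refine h2.congr' ?_
    filter_upwards [eventually_gt_atTop 0] with p hp
    rcases eq_or_ne x 0 with rfl | hx
    · simp
    have hs : 0 < √p := Real.sqrt_pos.2 hp
    have hs2 : √p ^ 2 = p := Real.sq_sqrt hp.le
    have hy : x / √p / 2 ≠ 0 := by positivity
    have hc : Real.cos (x / √p) = 1 - 2 * Real.sin (x / √p / 2) ^ 2 := by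
      have := Real.cos_two_mul (x / √p / 2)
      rw [mul_div_cancel₀ _ (two_ne_zero)] at this
      rw [this, Real.cos_sq']; ring
    rw [Real.sinc_of_ne_zero hy, hc]
    field_simp
    rw [hs2]; ring
  have := Real.tendsto_one_add_rpow_exp_of_tendsto h
  simpa using this

lemma aux_scale {p : ℝ} (hp : 0 < p) :
    √p * (∫ θ in (0:ℝ)..(π / 2), Real.cos θ ^ p) =
      ∫ x in Ioi (0:ℝ), (Ioc 0 (√p * (π / 2))).indicator (fun x => Real.cos (x / √p) ^ p) x := by
  have hs : 0 < √p := Real.sqrt_pos.2 hp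
  have hpi := Real.pi_pos
  have := intervalIntegral.integral_comp_div (a := 0) (b := √p * (π / 2))
    (fun θ => Real.cos θ ^ p) hs.ne'
  rw [zero_div, mul_div_cancel_left₀ _ hs.ne', smul_eq_mul] at this
  rw [← this, intervalIntegral.integral_of_le (by positivity),
    MeasureTheory.setIntegral_indicator measurableSet_Ioc,
    Set.inter_eq_right.2 Ioc_subset_Ioi_self]

lemma aux_W :
    Tendsto (fun p : ℝ => √p * (∫ θ in (0:ℝ)..(π / 2), Real.cos θ ^ p)) atTop
      (𝓝 (√(π / (1/2)) / 2)) := by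
  rw [← integral_gaussian_Ioi]
  have key : Tendsto (fun p : ℝ => ∫ x in Ioi (0:ℝ),
      (Ioc 0 (√p * (π / 2))).indicator (fun x => Real.cos (x / √p) ^ p) x) atTop
      (𝓝 (∫ x in Ioi (0:ℝ), Real.exp (-(1/2) * x ^ 2))) := by
    refine MeasureTheory.tendsto_integral_filter_of_dominated_convergence
      (fun x => Real.exp (-(2 / π ^ 2) * x ^ 2)) ?_ ?_ ?_ ?_
    · filter_upwards with p
      refine Measurable.aestronglyMeasurable ?_
      refine Measurable.indicator ?_ measurableSet_Ioc
      fun_prop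
    · filter_upwards [eventually_gt_atTop 0] with p hp
      filter_upwards with x
      by_cases hx : x ∈ Ioc 0 (√p * (π / 2))
      · rw [indicator_of_mem hx]
        have hs : 0 < √p := Real.sqrt_pos.2 hp
        have hs2 : √p ^ 2 = p := Real.sq_sqrt hp.le
        have hy0 : 0 ≤ x / √p := div_nonneg hx.1.le hs.le
        have hy1 : x / √p ≤ π / 2 := by
          rw [div_le_iff₀ hs]; linarith [hx.2]
        have hc : 0 ≤ Real.cos (x / √p) :=
          Real.cos_nonneg_of_neg_pi_div_two_le_of_le (by linarith [Real.pi_pos]) hy1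
        rw [Real.norm_of_nonneg (Real.rpow_nonneg hc _)]
        have h1 : Real.cos (x / √p) ≤ Real.exp (-(2 / π ^ 2) * (x / √p) ^ 2) := by
          have a := Real.cos_le_one_sub_mul_cos_sq (x := x / √p)
            (by rw [abs_of_nonneg hy0]; linarith [Real.pi_pos])
          have b := Real.add_one_le_exp (-(2 / π ^ 2) * (x / √p) ^ 2)
          linarith
        refine (Real.rpow_le_rpow hc h1 hp.le).trans_eq ?_
        rw [← Real.exp_mul, div_pow, hs2]
        congr 1
        field_simp
      · rw [indicator_of_notMem hx]; simp [Real.exp_nonneg]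
    · exact (integrable_exp_neg_mul_sq (by have := Real.pi_pos; positivity)).integrableOn
    · refine (MeasureTheory.ae_restrict_iff' measurableSet_Ioi).2 (Eventually.of_forall ?_)
      intro x hx
      refine (aux_pointwise x).congr' ?_
      have : Tendsto (fun p : ℝ => √p * (π / 2)) atTop atTop :=
        Real.tendsto_sqrt_atTop.atTop_mul_const (by have := Real.pi_pos; positivity)
      filter_upwards [this.eventually_ge_atTop x] with p hp
      have hm : x ∈ Ioc 0 (√p * (π / 2)) := ⟨hx, hp⟩
      rw [indicator_of_mem hm]
  refine key.congr' ?_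
  filter_upwards [eventually_gt_atTop 0] with p hp
  exact (aux_scale hp).symm

/-- The peak value of the rescaled Barenblatt profile converges to the peak value of the
limit Gaussian: `A(γ)^{1/(γ−1)} → λ/(2√π)` as `γ → 1⁺`. -/
theorem barenblatt_peak_tendsto (lam : ℝ) (hlam : 0 < lam) :
    Tendsto (fun γ => Acoef lam γ ^ ((1:ℝ) / (γ - 1))) (𝓝[>] (1:ℝ))
      (𝓝 (lam / (2 * Real.sqrt π))) := by
  have hpi := Real.pi_pos
  have hid : Tendsto (fun γ : ℝ => γ) (𝓝[>] (1:ℝ)) (𝓝 1) := tendsto_id.mono_left nhdsWithin_le_nhds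
  have hp : Tendsto (fun γ : ℝ => (γ + 1) / (γ - 1)) (𝓝[>] (1:ℝ)) atTop := by
    have h1 : Tendsto (fun γ : ℝ => γ - 1) (𝓝[>] (1:ℝ)) (𝓝[>] 0) := by
      refine tendsto_nhdsWithin_iff.2 ⟨by simpa using hid.sub_const 1, ?_⟩
      filter_upwards [self_mem_nhdsWithin] with γ hγ
      simpa using hγ
    have h2 := tendsto_inv_nhdsGT_zero.comp h1
    exact (hid.add_const 1).pos_mul_atTop (by norm_num) h2
  have hW := aux_W.comp hp
  have hB : Tendsto (fun γ : ℝ => √(1 / (2 * γ))) (𝓝[>] (1:ℝ)) (𝓝 (√(1 / (2 * 1)))) :=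
    ((tendsto_const_nhds.div (hid.const_mul 2) (by norm_num))).sqrt
  have hX := (hB.const_mul lam).div (hW.const_mul 2) (by positivity)
  have he : Tendsto (fun γ : ℝ => 2 / (γ + 1)) (𝓝[>] (1:ℝ)) (𝓝 1) := by
    have := (tendsto_const_nhds (x := (2:ℝ))).div (hid.add_const 1) (by norm_num)
    norm_num at this
    exact this
  have hF := hX.rpow he (Or.inr one_pos)
  have hl : (lam * √(1 / (2 * 1)) / (2 * (√(π / (1/2)) / 2))) ^ (1:ℝ) = lam / (2 * √π) := by
    have h2 : √(2:ℝ) ^ 2 = 2 := Real.sq_sqrt (by norm_num)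
    rw [Real.rpow_one, mul_one, Real.sqrt_div zero_le_one, Real.sqrt_one,
      show π / (1/2) = 2 * π by ring, Real.sqrt_mul (by norm_num)]
    field_simp
    rw [h2]
  rw [hl] at hF
  refine hF.congr' ?_
  filter_upwards [self_mem_nhdsWithin] with γ hγ
  have hγ : 1 < γ := hγ
  have hg : 0 < γ - 1 := by linarith
  have hW0 : 0 ≤ Wint γ := by
    refine intervalIntegral.integral_nonneg (by positivity) fun θ hθ => Real.rpow_nonneg ?_ _
    exact Real.cos_nonneg_of_neg_pi_div_two_le_of_le (by linarith [hθ.1]) hθ.2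
  have hB0 : 0 < Bcoef γ := by unfold Bcoef; positivity
  have hq : 0 < √((γ + 1) / (γ - 1)) := Real.sqrt_pos.2 (by positivity)
  unfold Acoef
  rw [← Real.rpow_mul (by positivity),
    show 2 * (γ - 1) / (γ + 1) * (1 / (γ - 1)) = 2 / (γ + 1) by field_simp,
    ← Real.sqrt_eq_rpow]
  have e : √(1 / (2 * γ)) = √((γ + 1) / (γ - 1)) * √(Bcoef γ) := by
    rw [← Real.sqrt_mul (by positivity)]
    congr 1
    unfold Bcoef
    field_simp
  simp only [Function.comp, Pi.div_apply]
  congr 1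
  rw [e]
  change _ / (2 * (_ * Wint γ)) = _
  rw [mul_left_comm, mul_left_comm 2, mul_div_mul_left _ _ hq.ne']
end

section
/- The Wallis-type integral satisfies the asymptotic lim_{ε → 0⁺} ε^{−1/2} ∫_0^{π/2} (cos θ)^{1 + 2/ε} dθ = √π / 2. -/
open Real Filter Topology Set

lemma wallis_ptwise (t : ℝ) :
    Tendsto (fun ε : ℝ => Real.cos (√ε * t) ^ (1 + 2 / ε)) (𝓝[>] (0:ℝ))
      (𝓝 (Real.exp (-1 * t ^ 2))) := by
  have hsm : ∀ᶠ ε : ℝ in 𝓝[>] (0:ℝ), ε * t ^ 2 < 1 := by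
    apply eventually_nhdsWithin_of_eventually_nhds
    have : Tendsto (fun ε : ℝ => ε * t ^ 2) (𝓝 0) (𝓝 (0 * t ^ 2)) :=
      (continuous_id.mul continuous_const).tendsto 0
    exact this.eventually_lt_const (by norm_num)
  have hlow : Tendsto (fun ε : ℝ => (ε + 2) * (-(t ^ 2 / 2) / (1 - ε * t ^ 2 / 2)))
      (𝓝[>] (0:ℝ)) (𝓝 (-1 * t ^ 2)) := by
    have : ContinuousAt (fun ε : ℝ => (ε + 2) * (-(t ^ 2 / 2) / (1 - ε * t ^ 2 / 2))) 0 := by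
      apply ContinuousAt.mul (by fun_prop)
      apply ContinuousAt.div (by fun_prop) (by fun_prop)
      norm_num
    have h := this.tendsto.mono_left (nhdsWithin_le_nhds (s := Ioi (0:ℝ)))
    convert h using 2
    ring
  have hup : Tendsto (fun ε : ℝ => (ε + 2) * (-(t ^ 2 / 2) + 5 / 96 * ε * t ^ 4))
      (𝓝[>] (0:ℝ)) (𝓝 (-1 * t ^ 2)) := by
    have : ContinuousAt (fun ε : ℝ => (ε + 2) * (-(t ^ 2 / 2) + 5 / 96 * ε * t ^ 4)) 0 := by
      fun_prop
    have h := this.tendsto.mono_left (nhdsWithin_le_nhds (s := Ioi (0:ℝ)))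
    convert h using 2
    ring
  have hlog : Tendsto (fun ε : ℝ => Real.log (Real.cos (√ε * t)) * (1 + 2 / ε)) (𝓝[>] (0:ℝ))
      (𝓝 (-1 * t ^ 2)) := by
    refine tendsto_of_tendsto_of_tendsto_of_le_of_le' hlow hup ?_ ?_
    · filter_upwards [hsm, self_mem_nhdsWithin] with ε h1 (h0 : 0 < ε)
      have hx : (√ε * t) ^ 2 = ε * t ^ 2 := by rw [mul_pow, sq_sqrt h0.le]
      have hc := Real.one_sub_sq_div_two_le_cos (x := √ε * t)
      rw [hx] at hc
      have hd : 0 < 1 - ε * t ^ 2 / 2 := by linarith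
      have hl := Real.one_sub_inv_le_log_of_pos (hd.trans_le hc)
      have hi := inv_anti₀ hd hc
      have : (ε + 2) * (-(t ^ 2 / 2) / (1 - ε * t ^ 2 / 2))
          = (1 - (1 - ε * t ^ 2 / 2)⁻¹) * (1 + 2 / ε) := by
        have := hd.ne'
        generalize hD : 1 - ε * t ^ 2 / 2 = D at *
        have e : t ^ 2 / 2 = (1 - D) / ε := by rw [← hD]; field_simp; ring
        rw [e]; field_simp; ring
      rw [this]
      apply mul_le_mul_of_nonneg_right (by linarith) (by positivity)
    · filter_upwards [hsm, self_mem_nhdsWithin] with ε h1 (h0 : 0 < ε)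
      have hx : (√ε * t) ^ 2 = ε * t ^ 2 := by rw [mul_pow, sq_sqrt h0.le]
      have hc := Real.one_sub_sq_div_two_le_cos (x := √ε * t)
      have hb := Real.cos_bound (x := √ε * t) (by
        rw [← sq_le_one_iff_abs_le_one, hx]; exact h1.le)
      have h4 : |√ε * t| ^ 4 = ε ^ 2 * t ^ 4 := by
        rw [show |√ε * t| ^ 4 = (|√ε * t| ^ 2) ^ 2 by ring, sq_abs, hx]; ring
      rw [h4, hx] at hb
      rw [hx] at hc
      have hd : 0 < 1 - ε * t ^ 2 / 2 := by linarith
      have hl := Real.log_le_sub_one_of_pos (hd.trans_le hc)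
      have hb2 := (abs_le.1 hb).2
      have : (ε + 2) * (-(t ^ 2 / 2) + 5 / 96 * ε * t ^ 4)
          = (-(ε * t ^ 2 / 2) + ε ^ 2 * t ^ 4 * (5 / 96)) * (1 + 2 / ε) := by
        field_simp
      rw [this]
      apply mul_le_mul_of_nonneg_right (by linarith) (by positivity)
  refine ((Real.continuous_exp.tendsto _).comp hlog).congr' ?_
  filter_upwards [hsm, self_mem_nhdsWithin] with ε h1 (h0 : 0 < ε)
  have hx : (√ε * t) ^ 2 = ε * t ^ 2 := by rw [mul_pow, sq_sqrt h0.le]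
  have hc := Real.one_sub_sq_div_two_le_cos (x := √ε * t)
  rw [hx] at hc
  simp only [Function.comp]
  rw [Real.rpow_def_of_pos (by linarith)]

lemma wallis_bound {ε t : ℝ} (h0 : 0 < ε) (ht : 0 < t) (ht2 : √ε * t ≤ π / 2) :
    Real.cos (√ε * t) ^ (1 + 2 / ε) ≤ Real.exp (-(4 / π ^ 2) * t ^ 2) := by
  have hs : 0 < √ε := Real.sqrt_pos.2 h0
  have hp := Real.pi_pos
  have hst : 0 < √ε * t := by positivity
  have hx : (√ε * t) ^ 2 = ε * t ^ 2 := by rw [mul_pow, sq_sqrt h0.le]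
  have hc := Real.cos_le_one_sub_mul_cos_sq (x := √ε * t) (by
    rw [abs_of_pos hst]; linarith)
  have hc0 : 0 ≤ Real.cos (√ε * t) := Real.cos_nonneg_of_neg_pi_div_two_le_of_le (by linarith) ht2
  have he := Real.add_one_le_exp (-(2 / π ^ 2 * (ε * t ^ 2)))
  rw [hx] at hc
  calc _ ≤ (Real.exp (-(2 / π ^ 2 * (ε * t ^ 2)))) ^ (1 + 2 / ε) :=
        Real.rpow_le_rpow hc0 (by linarith) (by positivity)
    _ = Real.exp (-(2 / π ^ 2 * (ε * t ^ 2)) * (1 + 2 / ε)) := by rw [← Real.exp_mul]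
    _ ≤ _ := by
      apply Real.exp_le_exp.2
      have : -(2 / π ^ 2 * (ε * t ^ 2)) * (1 + 2 / ε)
        = -(4 / π ^ 2) * t ^ 2 - 2 / π ^ 2 * (ε * t ^ 2) := by field_simp; ring
      rw [this]
      have : 0 ≤ 2 / π ^ 2 * (ε * t ^ 2) := by positivity
      linarith

/-- The Wallis-type integral satisfies
`lim_{ε → 0⁺} ε^{−1/2} ∫_0^{π/2} (cos θ)^{1 + 2/ε} dθ = √π / 2`. -/
theorem wallis_integral_asymptotic :
    Tendsto (fun ε : ℝ => ε ^ (-(1:ℝ) / 2) * ∫ θ in (0:ℝ)..(π / 2), Real.cos θ ^ (1 + 2 / ε))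
      (𝓝[>] (0:ℝ)) (𝓝 (Real.sqrt π / 2)) := by
  have hp := Real.pi_pos
  have key : Tendsto (fun ε : ℝ => ∫ t in Ioi (0:ℝ),
      (Ioc 0 (π / 2 / √ε)).indicator (fun t => Real.cos (√ε * t) ^ (1 + 2 / ε)) t)
      (𝓝[>] (0:ℝ)) (𝓝 (∫ t in Ioi (0:ℝ), Real.exp (-1 * t ^ 2))) := by
    apply MeasureTheory.tendsto_integral_filter_of_dominated_convergence
      (fun t => Real.exp (-(4 / π ^ 2) * t ^ 2))
    · filter_upwards with ε
      apply Measurable.aestronglyMeasurable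
      apply Measurable.indicator _ measurableSet_Ioc
      fun_prop
    · filter_upwards [self_mem_nhdsWithin] with ε (h0 : 0 < ε)
      filter_upwards with t
      have hs : 0 < √ε := Real.sqrt_pos.2 h0
      by_cases h : t ∈ Ioc 0 (π / 2 / √ε)
      · rw [indicator_of_mem h]
        have h2 : √ε * t ≤ π / 2 := by
          have := h.2
          rw [le_div_iff₀ hs] at this
          linarith
        have : 0 < √ε * t := mul_pos hs h.1
        rw [Real.norm_of_nonneg (Real.rpow_nonneg
          (Real.cos_nonneg_of_neg_pi_div_two_le_of_le (by linarith) h2) _)]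
        exact wallis_bound h0 h.1 h2
      · rw [indicator_of_notMem h]
        simp [Real.exp_nonneg]
    · exact (integrable_exp_neg_mul_sq (by positivity)).integrableOn
    · filter_upwards [MeasureTheory.ae_restrict_mem measurableSet_Ioi] with t (ht : 0 < t)
      refine (wallis_ptwise t).congr' ?_
      have hsm : ∀ᶠ ε : ℝ in 𝓝[>] (0:ℝ), √ε * t < π / 2 := by
        apply eventually_nhdsWithin_of_eventually_nhds
        have : Tendsto (fun ε : ℝ => √ε * t) (𝓝 0) (𝓝 (√0 * t)) :=
          (Real.continuous_sqrt.mul continuous_const).tendsto 0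
        exact this.eventually_lt_const (by simp; positivity)
      filter_upwards [hsm, self_mem_nhdsWithin] with ε h1 (h0 : 0 < ε)
      rw [indicator_of_mem]
      refine ⟨ht, ?_⟩
      rw [le_div_iff₀ (Real.sqrt_pos.2 h0)]
      linarith
  rw [integral_gaussian_Ioi, div_one] at key
  refine key.congr' ?_
  filter_upwards [self_mem_nhdsWithin] with ε (h0 : 0 < ε)
  have hs : 0 < √ε := Real.sqrt_pos.2 h0
  rw [MeasureTheory.setIntegral_indicator measurableSet_Ioc,
    inter_eq_right.2 Ioc_subset_Ioi_self,
    ← intervalIntegral.integral_of_le (by positivity),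
    intervalIntegral.integral_comp_mul_left (fun x => Real.cos x ^ (1 + 2 / ε)) hs.ne']
  rw [mul_zero, mul_div_cancel₀ _ hs.ne', smul_eq_mul, neg_div, Real.rpow_neg h0.le,
    Real.sqrt_eq_rpow]
end

section
/- The ratio B(γ)/A(γ) satisfies lim_{γ → 1⁺} B(γ) / ((γ−1) A(γ)) = 1/4; in particular B(γ)/A(γ) = (γ−1)/4 + O((γ−1)²) as γ → 1⁺. -/
open Real Filter Topology Set Asymptotics

lemma W_upper (γ : ℝ) (h1 : 1 < γ) (h2 : γ ≤ 2) : Wint γ ≤ 2 * √(γ - 1) := by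
  have he : 0 < γ - 1 := by linarith
  set p := (γ + 1) / (γ - 1) with hp
  have hp0 : 0 < p := by positivity
  have hpi := Real.pi_pos
  have hb : 0 < 2 / π ^ 2 * p := by positivity
  have hcont : Continuous fun θ : ℝ => Real.cos θ ^ p :=
    Real.continuous_cos.rpow_const (fun _ => Or.inr hp0.le)
  have key : Wint γ ≤ ∫ θ in (0:ℝ)..(π / 2), Real.exp (-(2 / π ^ 2 * p) * θ ^ 2) := by
    unfold Wint
    apply intervalIntegral.integral_mono_on (by positivity) (hcont.intervalIntegrable _ _)
      (Continuous.intervalIntegrable (by fun_prop) _ _)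
    intro x hx
    have hc : 0 ≤ Real.cos x := Real.cos_nonneg_of_mem_Icc ⟨by linarith [hx.1], hx.2⟩
    have h3 : Real.cos x ≤ 1 - 2 / π ^ 2 * x ^ 2 :=
      Real.cos_le_one_sub_mul_cos_sq (by rw [abs_of_nonneg hx.1]; linarith [hx.2])
    have h4 : Real.cos x ≤ Real.exp (-(2 / π ^ 2 * x ^ 2)) := by
      linarith [Real.add_one_le_exp (-(2 / π ^ 2 * x ^ 2))]
    calc Real.cos x ^ p ≤ Real.exp (-(2 / π ^ 2 * x ^ 2)) ^ p :=
          Real.rpow_le_rpow hc h4 hp0.le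
      _ = _ := by rw [← Real.exp_mul]; congr 1; ring
  have key2 : ∫ θ in (0:ℝ)..(π / 2), Real.exp (-(2 / π ^ 2 * p) * θ ^ 2)
      ≤ √(π / (2 / π ^ 2 * p)) / 2 := by
    rw [← integral_gaussian_Ioi, intervalIntegral.integral_of_le (by positivity)]
    apply MeasureTheory.setIntegral_mono_set
    · exact (integrable_exp_neg_mul_sq hb).integrableOn
    · exact Eventually.of_forall fun x => (Real.exp_pos _).le
    · exact (Ioc_subset_Ioi_self).eventuallyLE
  have key3 : √(π / (2 / π ^ 2 * p)) ≤ 4 * √(γ - 1) := by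
    have : (4:ℝ) * √(γ - 1) = √(16 * (γ - 1)) := by
      rw [Real.sqrt_mul (by norm_num), show (16:ℝ) = 4 ^ 2 by norm_num, Real.sqrt_sq (by norm_num)]
    rw [this]
    apply Real.sqrt_le_sqrt
    have h5 : π / (2 / π ^ 2 * p) = π ^ 3 * (γ - 1) / (2 * (γ + 1)) := by
      rw [hp]; field_simp
    rw [h5, div_le_iff₀ (by positivity)]
    have h6 : π ^ 3 ≤ 64 := by
      calc π ^ 3 ≤ 4 ^ 3 := pow_le_pow_left₀ hpi.le Real.pi_le_four 3
        _ = 64 := by norm_num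
    nlinarith
  linarith

lemma W_lower (γ : ℝ) (h1 : 1 < γ) (h2 : γ ≤ 2) : √(γ - 1) / 4 ≤ Wint γ := by
  have he : 0 < γ - 1 := by linarith
  set p := (γ + 1) / (γ - 1) with hp
  have hp0 : 0 < p := by positivity
  have hp1 : 1 ≤ p := by rw [hp, le_div_iff₀ he]; linarith
  have hpi := Real.pi_gt_three
  have hs : 0 < √(γ - 1) := Real.sqrt_pos.2 he
  have hs1 : √(γ - 1) ≤ 1 := Real.sqrt_le_one.2 (by linarith)
  have hsq : √(γ - 1) ^ 2 = γ - 1 := Real.sq_sqrt he.le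
  have hcont : Continuous fun θ : ℝ => Real.cos θ ^ p :=
    Real.continuous_cos.rpow_const (fun _ => Or.inr hp0.le)
  have hsub : ∫ θ in (0:ℝ)..(√(γ - 1) / 2), Real.cos θ ^ p ≤ Wint γ := by
    unfold Wint
    apply intervalIntegral.integral_mono_interval le_rfl (by positivity) (by linarith)
    · refine (MeasureTheory.ae_restrict_iff' measurableSet_Ioc).2 (Eventually.of_forall ?_)
      intro x hx
      exact Real.rpow_nonneg (Real.cos_nonneg_of_mem_Icc ⟨by linarith [hx.1], hx.2⟩) _
    · exact hcont.intervalIntegrable _ _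
  have hlow : ∫ θ in (0:ℝ)..(√(γ - 1) / 2), (1 / 2 : ℝ)
      ≤ ∫ θ in (0:ℝ)..(√(γ - 1) / 2), Real.cos θ ^ p := by
    apply intervalIntegral.integral_mono_on (by positivity) (by simp)
      (hcont.intervalIntegrable _ _)
    intro x hx
    have hx2 : x ^ 2 ≤ (γ - 1) / 4 := by
      have := pow_le_pow_left₀ hx.1 hx.2 2
      nlinarith
    have h3 := Real.one_sub_sq_div_two_le_cos (x := x)
    have h4 : 1 + -((γ - 1) / 8) ≤ Real.cos x := by linarith
    have h5 := one_add_mul_self_le_rpow_one_add (s := -((γ - 1) / 8)) (by linarith) hp1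
    have h6 : p * (γ - 1) = γ + 1 := by rw [hp]; field_simp
    calc (1 / 2 : ℝ) ≤ 1 + p * -((γ - 1) / 8) := by nlinarith
      _ ≤ _ := h5
      _ ≤ _ := Real.rpow_le_rpow (by linarith) h4 hp0.le
  rw [intervalIntegral.integral_const] at hlow
  simp only [smul_eq_mul] at hlow
  linarith

lemma A_bound (lam : ℝ) (hlam : 0 < lam) : ∃ C : ℝ, 0 ≤ C ∧ ∀ γ : ℝ, 1 < γ → γ ≤ 2 →
    ∃ t : ℝ, |t| ≤ C * (γ - 1) ∧ (Acoef lam γ)⁻¹ = Real.exp t := by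
  refine ⟨max |Real.log (lam / 16)| |Real.log lam|, by positivity, ?_⟩
  intro γ h1 h2
  have he : 0 < γ - 1 := by linarith
  have hs : 0 < √(γ - 1) := Real.sqrt_pos.2 he
  have hsq : √(γ - 1) ^ 2 = γ - 1 := Real.sq_sqrt he.le
  have hWu := W_upper γ h1 h2
  have hWl := W_lower γ h1 h2
  have hW : 0 < Wint γ := by linarith [div_pos hs (by norm_num : (0:ℝ) < 4)]
  have hBl : √(γ - 1) / 4 ≤ Bcoef γ ^ ((1:ℝ) / 2) := by
    rw [← Real.sqrt_eq_rpow]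
    apply Real.le_sqrt_of_sq_le
    rw [div_pow, hsq, Bcoef]
    apply div_le_div_of_nonneg_left he.le (by positivity)
    nlinarith
  have hBu : Bcoef γ ^ ((1:ℝ) / 2) ≤ √(γ - 1) / 2 := by
    rw [← Real.sqrt_eq_rpow]
    apply Real.sqrt_le_iff.2 ⟨by positivity, ?_⟩
    rw [div_pow, hsq, Bcoef]
    apply div_le_div_of_nonneg_left he.le (by positivity)
    nlinarith
  set b := Bcoef γ ^ ((1:ℝ) / 2) with hb
  set X := lam * b / (2 * Wint γ) with hX
  have hXl : lam / 16 ≤ X := by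
    rw [hX, le_div_iff₀ (by positivity)]
    nlinarith
  have hXu : X ≤ lam := by
    rw [hX, div_le_iff₀ (by positivity)]
    nlinarith
  have hX0 : 0 < X := by linarith
  have hlog : |Real.log X| ≤ max |Real.log (lam / 16)| |Real.log lam| :=
    abs_le_max_abs_abs (Real.log_le_log (by positivity) hXl) (Real.log_le_log hX0 hXu)
  refine ⟨-(Real.log X * (2 * (γ - 1) / (γ + 1))), ?_, ?_⟩
  · rw [abs_neg, abs_mul]
    have h3 : |2 * (γ - 1) / (γ + 1)| ≤ γ - 1 := by
      rw [abs_of_nonneg (by positivity), div_le_iff₀ (by positivity)]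
      nlinarith
    exact mul_le_mul hlog h3 (abs_nonneg _) (by positivity)
  · rw [Real.exp_neg, ← Real.rpow_def_of_pos hX0]
    rfl

lemma main_bound (lam : ℝ) (hlam : 0 < lam) :
    (fun γ => Bcoef γ / ((γ - 1) * Acoef lam γ) - 1 / 4) =O[𝓝[>] (1:ℝ)] fun γ => γ - 1 := by
  obtain ⟨C, hC, h⟩ := A_bound lam hlam
  refine IsBigO.of_bound (2 * C + 1) ?_
  have hδ : 0 < min 1 (1 / (C + 1)) := by positivity
  filter_upwards [Ioo_mem_nhdsGT (show (1:ℝ) < 1 + min 1 (1 / (C + 1)) by linarith)] with γ hγ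
  have h1 : 1 < γ := hγ.1
  have he : 0 < γ - 1 := by linarith
  have h2 : γ ≤ 2 := by linarith [hγ.2, min_le_left 1 (1 / (C + 1))]
  have h3 : γ - 1 ≤ 1 / (C + 1) := by linarith [hγ.2, min_le_right 1 (1 / (C + 1))]
  rw [le_div_iff₀ (by positivity)] at h3
  obtain ⟨t, ht, hA⟩ := h γ h1 h2
  have hexp : |Real.exp t - 1| ≤ 2 * |t| := Real.abs_exp_sub_one_le (by nlinarith)
  have e1 : Bcoef γ / ((γ - 1) * Acoef lam γ) = 1 / (2 * γ * (γ + 1)) * Real.exp t := by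
    rw [← hA, Bcoef, div_mul_eq_div_div, div_eq_mul_inv _ (Acoef lam γ)]
    congr 1
    field_simp
  rw [Real.norm_eq_abs, Real.norm_eq_abs, abs_of_pos he, e1]
  set q := 1 / (2 * γ * (γ + 1)) with hq
  have hq0 : 0 < q := by positivity
  have hq1 : q ≤ 1 / 4 := by
    rw [hq]; apply one_div_le_one_div_of_le (by norm_num); nlinarith
  have hq2 : 1 / 4 - (γ - 1) ≤ q := by
    rw [hq, le_div_iff₀ (by positivity)]; nlinarith [mul_pos he he, mul_pos he (mul_pos he he)]
  calc |q * Real.exp t - 1 / 4| = |q * (Real.exp t - 1) + (q - 1 / 4)| := by congr 1; ring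
    _ ≤ |q * (Real.exp t - 1)| + |q - 1 / 4| := abs_add_le _ _
    _ ≤ 2 * C * (γ - 1) + (γ - 1) := by
      rw [abs_mul, abs_of_pos hq0]
      have : |q - 1 / 4| ≤ γ - 1 := by rw [abs_le]; constructor <;> linarith
      have := abs_nonneg (Real.exp t - 1)
      nlinarith
    _ = _ := by ring

/-- The ratio `B(γ)/A(γ)` satisfies `lim_{γ → 1⁺} B(γ)/((γ−1)A(γ)) = 1/4`; in particular
`B(γ)/A(γ) = (γ−1)/4 + O((γ−1)²)` as `γ → 1⁺`. -/
theorem barenblatt_ratio_asymptotic (lam : ℝ) (hlam : 0 < lam) :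
    Tendsto (fun γ => Bcoef γ / ((γ - 1) * Acoef lam γ)) (𝓝[>] (1:ℝ)) (𝓝 (1 / 4)) ∧
      (fun γ => Bcoef γ / Acoef lam γ - (γ - 1) / 4) =O[𝓝[>] (1:ℝ)] fun γ => (γ - 1) ^ 2 := by
  have hO := main_bound lam hlam
  constructor
  · have h0 : Tendsto (fun γ : ℝ => γ - 1) (𝓝[>] (1:ℝ)) (𝓝 0) := by
      have : Tendsto (fun γ : ℝ => γ - 1) (𝓝 (1:ℝ)) (𝓝 (1 - 1)) :=
        (continuous_id.sub continuous_const).tendsto 1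
      rw [sub_self] at this
      exact this.mono_left nhdsWithin_le_nhds
    have := (hO.trans_tendsto h0).add_const (1 / 4)
    simpa using this
  · have := (isBigO_refl (fun γ : ℝ => γ - 1) (𝓝[>] (1:ℝ))).mul hO
    refine this.congr' ?_ ?_
    · filter_upwards [self_mem_nhdsWithin] with γ hγ
      have he : γ - 1 ≠ 0 := sub_ne_zero.2 (ne_of_gt hγ)
      rw [mul_sub, div_mul_eq_div_div_swap]
      congr 1
      · rw [mul_div_cancel₀ _ he]
      · ring
    · exact Eventually.of_forall fun γ => by ring
end

section
/- Gaussian functions are exact solutions of the isothermal Euler system with damping: with α(t) = α₀/τ(t)², β(t) = τ̇(t)/τ(t), b(t) = b₀/τ(t), and x̄, c as in the context, the functions ρ̄(t,x) = b(t) e^{−α(t)(x − x̄(t))²} and m̄(t,x) = (β(t)x + c(t)) ρ̄(t,x) satisfy, for all t ≥ 0 and x ∈ ℝ, the continuity equation ∂_t ρ̄ + ∂_x m̄ = 0 and the momentum equation ∂_t m̄ + ∂_x(m̄²/ρ̄) + ∂_x ρ̄ + m̄ = 0. -/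
open Real Filter Topology Set

/-- The Gaussian density `ρ̄(t,x) = b(t) e^{−α(t)(x−x̄(t))²}` with `b(t) = b₀/τ(t)` and
`α(t) = α₀/τ(t)²`. -/
noncomputable def gaussDensity (α₀ b₀ : ℝ) (τ xbar : ℝ → ℝ) (t x : ℝ) : ℝ :=
  b₀ / τ t * Real.exp (-(α₀ / τ t ^ 2) * (x - xbar t) ^ 2)

/-- The Gaussian momentum `m̄(t,x) = (β(t)x + c(t)) ρ̄(t,x)` with `β(t) = τ̇(t)/τ(t)`. -/
noncomputable def gaussMomentum (α₀ b₀ : ℝ) (τ τ' xbar c : ℝ → ℝ) (t x : ℝ) : ℝ :=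
  (τ' t / τ t * x + c t) * gaussDensity α₀ b₀ τ xbar t x

/-- Gaussian functions are exact solutions of the isothermal Euler system with damping:
with `α = α₀/τ²`, `β = τ̇/τ`, `b = b₀/τ`, and `x̄`, `c` solving the stated ODEs, the
functions `ρ̄(t,x) = b(t) e^{−α(t)(x−x̄(t))²}` and `m̄(t,x) = (β(t)x + c(t))ρ̄(t,x)`
satisfy `∂_t ρ̄ + ∂_x m̄ = 0` and `∂_t m̄ + ∂_x(m̄²/ρ̄) + ∂_x ρ̄ + m̄ = 0` for all
`t ≥ 0`, `x ∈ ℝ`.  Time derivatives are taken within `[0,∞)`. -/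
theorem gaussian_solves_isothermal_euler_damping
    (α₀ b₀ β₀ c₀ : ℝ) (hα₀ : 0 < α₀) (hb₀ : 0 < b₀)
    (τ τ' xbar c : ℝ → ℝ)
    (hτpos : ∀ t ≥ (0:ℝ), 0 < τ t)
    (hτC2 : ∀ t ≥ (0:ℝ), HasDerivWithinAt τ (τ' t) (Set.Ici 0) t)
    (hτode : ∀ t ≥ (0:ℝ), HasDerivWithinAt τ' (2 * α₀ / τ t - τ' t) (Set.Ici 0) t)
    (hτ0 : τ 0 = 1) (hτ'0 : τ' 0 = β₀)
    (hxbar : ∀ t ≥ (0:ℝ), HasDerivWithinAt xbar (τ' t / τ t * xbar t + c t) (Set.Ici 0) t)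
    (hc : ∀ t ≥ (0:ℝ), HasDerivWithinAt c
      (-(τ' t / τ t * c t) - c t - 2 * (α₀ / τ t ^ 2) * xbar t) (Set.Ici 0) t)
    (hxbar0 : xbar 0 = 0) (hc0 : c 0 = c₀) :
    ∀ t ≥ (0:ℝ), ∀ x : ℝ,
      (derivWithin (fun s => gaussDensity α₀ b₀ τ xbar s x) (Set.Ici 0) t
        + deriv (fun y => gaussMomentum α₀ b₀ τ τ' xbar c t y) x = 0) ∧
      (derivWithin (fun s => gaussMomentum α₀ b₀ τ τ' xbar c s x) (Set.Ici 0) t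
        + deriv (fun y => gaussMomentum α₀ b₀ τ τ' xbar c t y ^ 2
            / gaussDensity α₀ b₀ τ xbar t y) x
        + deriv (fun y => gaussDensity α₀ b₀ τ xbar t y) x
        + gaussMomentum α₀ b₀ τ τ' xbar c t x = 0) := by
  intro t ht x
  have hτ : τ t ≠ 0 := (hτpos t ht).ne'
  have hu : UniqueDiffWithinAt ℝ (Set.Ici (0:ℝ)) t := uniqueDiffOn_Ici 0 t ht
  have hρpos : ∀ y, gaussDensity α₀ b₀ τ xbar t y ≠ 0 := fun y =>
    (mul_pos (div_pos hb₀ (hτpos t ht)) (Real.exp_pos _)).ne'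
  -- time derivative of the density
  have h1 : HasDerivWithinAt (fun s => gaussDensity α₀ b₀ τ xbar s x)
      (gaussDensity α₀ b₀ τ xbar t x * (-(τ' t / τ t)
        + 2 * (α₀ / τ t ^ 2) * (τ' t / τ t) * (x - xbar t) ^ 2
        + 2 * (α₀ / τ t ^ 2) * (x - xbar t) * (τ' t / τ t * xbar t + c t))) (Set.Ici 0) t := by
    have hb := (hasDerivWithinAt_const t (Set.Ici (0:ℝ)) b₀).fun_div (hτC2 t ht) hτ
    have ha := ((hasDerivWithinAt_const t (Set.Ici (0:ℝ)) α₀).fun_div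
      ((hτC2 t ht).fun_pow 2) (pow_ne_zero 2 hτ)).fun_neg
    have hx := ((hxbar t ht).const_sub x).fun_pow 2
    have h := hb.fun_mul (ha.fun_mul hx).exp
    unfold gaussDensity
    refine h.congr_deriv ?_
    generalize Real.exp _ = E
    field_simp
    ring
  -- space derivative of the density
  have h2 : HasDerivAt (fun y => gaussDensity α₀ b₀ τ xbar t y)
      (gaussDensity α₀ b₀ τ xbar t x * (-(2 * (α₀ / τ t ^ 2) * (x - xbar t)))) x := by
    have hx := ((((hasDerivAt_id' x).sub_const (xbar t)).fun_pow 2).const_mul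
      (-(α₀ / τ t ^ 2))).exp.const_mul (b₀ / τ t)
    unfold gaussDensity
    refine hx.congr_deriv ?_
    generalize Real.exp _ = E
    field_simp
    ring
  -- velocity
  have h3 : HasDerivAt (fun y => τ' t / τ t * y + c t) (τ' t / τ t) x := by
    simpa using ((hasDerivAt_id' x).const_mul (τ' t / τ t)).add_const (c t)
  have h4 := (((hτode t ht).fun_div (hτC2 t ht) hτ).mul_const x).fun_add (hc t ht)
  have h5 : HasDerivAt (fun y => gaussMomentum α₀ b₀ τ τ' xbar c t y) _ x := h3.fun_mul h2
  have h6 : HasDerivWithinAt (fun s => gaussMomentum α₀ b₀ τ τ' xbar c s x) _ (Set.Ici 0) t :=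
    h4.fun_mul h1
  have he : (fun y => gaussMomentum α₀ b₀ τ τ' xbar c t y ^ 2 / gaussDensity α₀ b₀ τ xbar t y)
      = fun y => (τ' t / τ t * y + c t) * gaussMomentum α₀ b₀ τ τ' xbar c t y := by
    funext y
    have := hρpos y
    unfold gaussMomentum
    field_simp
  have h7 := h3.fun_mul h5
  rw [he, h1.derivWithin hu, h5.deriv, h6.derivWithin hu, h7.deriv, h2.deriv]
  unfold gaussMomentum
  generalize gaussDensity α₀ b₀ τ xbar t x = R
  constructor
  · field_simp
    ring
  · field_simp
    ring
end

section
/- The center of the Gaussian solution has the explicit expression x̄(t) = c(0)(1 − e^{−t}) for all t ≥ 0; in particular x̄(t) converges to the finite limit x̄_∞ = c(0) as t → ∞. (Equivalently, under the stated ODE system the center satisfies ẍ̄ = −ẋ̄ with x̄(0) = 0, ẋ̄(0) = c(0).) -/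
open Real Filter Topology Set

theorem const_aux (f : ℝ → ℝ) (hf : ∀ t ≥ (0:ℝ), HasDerivWithinAt f 0 (Set.Ici 0) t) :
    ∀ t ≥ (0:ℝ), f t = f 0 := by
  intro t ht
  refine constant_of_has_deriv_right_zero (a := 0) (b := t) ?_ ?_ t ⟨ht, le_refl t⟩
  · intro s hs
    exact (hf s hs.1).continuousWithinAt.mono Set.Icc_subset_Ici_self
  · intro s hs
    exact (hf s hs.1).mono (Set.Ici_subset_Ici.2 hs.1)

/-- The center of the Gaussian solution has the explicit expression
`x̄(t) = c(0)(1 − e^{−t})` for all `t ≥ 0`; in particular `x̄(t) → c(0)` as `t → ∞`. -/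
theorem gaussian_center_explicit (α₀ β₀ c₀ : ℝ) (hα₀ : 0 < α₀)
    (τ τ' xbar c : ℝ → ℝ)
    (hτpos : ∀ t ≥ (0:ℝ), 0 < τ t)
    (hτC2 : ∀ t ≥ (0:ℝ), HasDerivWithinAt τ (τ' t) (Set.Ici 0) t)
    (hτode : ∀ t ≥ (0:ℝ), HasDerivWithinAt τ' (2 * α₀ / τ t - τ' t) (Set.Ici 0) t)
    (hτ0 : τ 0 = 1) (hτ'0 : τ' 0 = β₀)
    (hxbar : ∀ t ≥ (0:ℝ), HasDerivWithinAt xbar (τ' t / τ t * xbar t + c t) (Set.Ici 0) t)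
    (hc : ∀ t ≥ (0:ℝ), HasDerivWithinAt c
      (-(τ' t / τ t * c t) - c t - 2 * (α₀ / τ t ^ 2) * xbar t) (Set.Ici 0) t)
    (hxbar0 : xbar 0 = 0) (hc0 : c 0 = c₀) :
    (∀ t ≥ (0:ℝ), xbar t = c₀ * (1 - Real.exp (-t))) ∧
      Tendsto xbar atTop (𝓝 c₀) := by
  have hv : ∀ t ≥ (0:ℝ), HasDerivWithinAt (fun s => τ' s / τ s * xbar s + c s)
      (-(τ' t / τ t * xbar t + c t)) (Set.Ici 0) t := by
    intro t ht
    have hp := (hτpos t ht).ne'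
    have h := (((hτode t ht).div (hτC2 t ht) hp).mul (hxbar t ht)).add (hc t ht)
    refine h.congr_deriv ?_
    simp only [Pi.div_apply]
    field_simp
    ring
  have h1 := const_aux (fun s => (τ' s / τ s * xbar s + c s) + xbar s) (by
    intro t ht
    exact ((hv t ht).add (hxbar t ht)).congr_deriv (by ring))
  have h2 := const_aux (fun s => (τ' s / τ s * xbar s + c s) * Real.exp s) (by
    intro t ht
    exact ((hv t ht).mul (Real.hasDerivAt_exp t).hasDerivWithinAt).congr_deriv (by ring))
  have key : ∀ t ≥ (0:ℝ), xbar t = c₀ * (1 - Real.exp (-t)) := by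
    intro t ht
    have e1 := h1 t ht
    have e2 := h2 t ht
    simp only [hxbar0, hc0, mul_zero, zero_add, add_zero, Real.exp_zero, mul_one] at e1 e2
    have e3 : Real.exp t * Real.exp (-t) = 1 := by rw [← Real.exp_add]; simp
    linear_combination e1 - Real.exp (-t) * e2 + (τ' t / τ t * xbar t + c t) * e3
  refine ⟨key, ?_⟩
  have hl : Tendsto (fun t : ℝ => c₀ * (1 - Real.exp (-t))) atTop (𝓝 c₀) := by
    simpa using (Real.tendsto_exp_neg_atTop_nhds_zero.const_sub 1).const_mul c₀
  refine hl.congr' ?_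
  filter_upwards [eventually_ge_atTop (0:ℝ)] with t ht
  exact (key t ht).symm
end

section
/- For every α₀ > 0 and β₀ ∈ ℝ there exists a unique global solution τ ∈ C^∞([0,∞)) of the ODE τ̈ = 2α₀/τ − τ̇ with τ(0) = 1 and τ̇(0) = β₀ taking values in (0,∞); moreover this solution is uniformly bounded from below by a strictly positive constant: inf_{t ≥ 0} τ(t) > 0. -/
open Real Filter Topology Set

lemma lip_div_max (a m : ℝ) (ha : 0 < a) (hm : 0 < m) :
    LipschitzWith (Real.toNNReal (a / m ^ 2)) (fun x : ℝ => a / max x m) := by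
  apply LipschitzWith.of_dist_le_mul
  intro x y
  rw [Real.coe_toNNReal _ (by positivity), Real.dist_eq, Real.dist_eq]
  have h1 : m ≤ max x m := le_max_right _ _
  have h2 : m ≤ max y m := le_max_right _ _
  have h3 : |max x m - max y m| ≤ |x - y| := abs_max_sub_max_le_abs x y m
  set p := max x m
  set q := max y m
  have hp : 0 < p := by linarith
  have hq : 0 < q := by linarith
  have : a / p - a / q = (a / (p * q)) * (q - p) := by field_simp
  rw [this, abs_mul, abs_of_pos (by positivity : 0 < a / (p * q)), abs_sub_comm q p]
  have h4 : a / (p * q) ≤ a / m ^ 2 := by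
    apply div_le_div_of_nonneg_left ha.le (by positivity)
    nlinarith
  exact mul_le_mul h4 h3 (abs_nonneg _) (by positivity)

lemma global_sol {E : Type*} [NormedAddCommGroup E] [NormedSpace ℝ E] [CompleteSpace E]
    (v : E → E) (K L : NNReal) (hv : LipschitzWith K v) (hb : ∀ x, ‖v x‖ ≤ L) (x₀ : E) :
    ∃ f : ℝ → E, f 0 = x₀ ∧ ∀ t, HasDerivAt f (v (f t)) t := by
  have h1 : ∀ n : ℕ, ∃ f : ℝ → E, f 0 = x₀ ∧
      ∀ t ∈ Ioo (-((n:ℝ) + 1)) (n + 1), HasDerivAt f (v (f t)) t := by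
    intro n
    have hn : (0:ℝ) < n + 1 := by positivity
    have hP : IsPicardLindelof (fun _ => v)
        (⟨0, by constructor <;> linarith⟩ : Icc (-((n:ℝ) + 1)) (n + 1)) x₀
        (L * ((n:NNReal) + 1)) 0 L K := by
      apply IsPicardLindelof.of_time_independent (fun x _ => hb x) hv.lipschitzOnWith
      simp
    obtain ⟨f, hf0, hf⟩ := hP.exists_eq_forall_mem_Icc_hasDerivWithinAt₀
    exact ⟨f, hf0, fun t ht => (hf t (Ioo_subset_Icc_self ht)).hasDerivAt
      (Icc_mem_nhds ht.1 ht.2)⟩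
  choose F hF0 hF using h1
  have hmono : ∀ m n : ℕ, m ≤ n → EqOn (F m) (F n) (Ioo (-((m:ℝ) + 1)) (m + 1)) := by
    intro m n hmn
    have hmn' : (m:ℝ) ≤ n := by exact_mod_cast hmn
    have hm : (0:ℝ) < m + 1 := by positivity
    apply ODE_solution_unique_of_mem_Ioo (v := fun _ => v) (s := fun _ => univ) (K := K)
      (t₀ := 0) (fun t _ => hv.lipschitzOnWith) ⟨by linarith, hm⟩
      (fun t ht => ⟨hF m t ht, trivial⟩)
      (fun t ht => ⟨hF n t ⟨by linarith [ht.1], by linarith [ht.2]⟩, trivial⟩)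
    rw [hF0, hF0]
  have key : ∀ (n : ℕ) (t : ℝ), t ∈ Ioo (-((n:ℝ) + 1)) (n + 1) → F ⌈|t|⌉₊ t = F n t := by
    intro n t ht
    have h2 : t ∈ Ioo (-((⌈|t|⌉₊:ℝ) + 1)) (⌈|t|⌉₊ + 1) := by
      have := abs_le.1 (Nat.le_ceil |t|)
      constructor <;> linarith [this.1, this.2]
    rcases le_total ⌈|t|⌉₊ n with h | h
    · exact hmono _ _ h h2
    · exact (hmono _ _ h ht).symm
  refine ⟨fun t => F ⌈|t|⌉₊ t, hF0 _, fun t => ?_⟩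
  have h2 : t ∈ Ioo (-((⌈|t|⌉₊:ℝ) + 1)) (⌈|t|⌉₊ + 1) := by
    have := abs_le.1 (Nat.le_ceil |t|)
    constructor <;> linarith [this.1, this.2]
  refine (hF _ t h2).congr_of_eventuallyEq ?_
  filter_upwards [Ioo_mem_nhds h2.1 h2.2] with s hs
  exact key _ s hs

/-- existence for the first-order system -/
lemma exists_system (α β : ℝ) (hα : 0 < α) :
    ∃ x y : ℝ → ℝ, ∃ ε > 0, x 0 = 1 ∧ y 0 = β ∧ (∀ t, 0 ≤ t → ε ≤ x t) ∧
      (∀ t, 0 ≤ t → HasDerivAt x (y t) t) ∧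
      (∀ t, 0 ≤ t → HasDerivAt y (2 * α / x t - y t) t) := by
  set ε := Real.exp (-(β ^ 2 / (4 * α))) with hε
  have hε0 : 0 < ε := Real.exp_pos _
  have hε1 : ε ≤ 1 := Real.exp_le_one_iff.2 (by have : 0 ≤ β ^ 2 / (4 * α) := by positivity
                                                linarith)
  set M := |β| + 2 * α / ε + 1 with hM
  have hM0 : 0 < M := by positivity
  set c : ℝ → ℝ := fun y => max (min y M) (-M) with hc
  have hclip : LipschitzWith 1 c := (LipschitzWith.id.min_const M).max_const (-M)
  have hcb : ∀ y, |c y| ≤ M := by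
    intro y
    rw [abs_le]
    exact ⟨le_max_right _ _, max_le (min_le_right _ _) (by linarith)⟩
  have hglip := lip_div_max (2 * α) ε (by positivity) hε0
  have hgpos : ∀ x : ℝ, 0 < 2 * α / max x ε := fun x =>
    div_pos (by positivity) (lt_of_lt_of_le hε0 (le_max_right _ _))
  have hgle : ∀ x : ℝ, 2 * α / max x ε ≤ 2 * α / ε := fun x =>
    div_le_div_of_nonneg_left (by positivity) hε0 (le_max_right _ _)
  set v : ℝ × ℝ → ℝ × ℝ := fun p => (c p.2, 2 * α / max p.1 ε - c p.2) with hv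
  have hvlip := (hclip.comp LipschitzWith.prod_snd).prodMk
    ((hglip.comp LipschitzWith.prod_fst).sub (hclip.comp LipschitzWith.prod_snd))
  have hvb : ∀ p, ‖v p‖ ≤ (Real.toNNReal (2 * M) : NNReal) := by
    intro p
    rw [Real.coe_toNNReal _ (by positivity), Prod.norm_def, Real.norm_eq_abs, Real.norm_eq_abs]
    have h1 := abs_le.1 (hcb p.2)
    have h2 := hgpos p.1
    have h3 := hgle p.1
    have h4 := abs_nonneg β
    apply max_le
    · exact (hcb _).trans (by linarith)
    · rw [abs_le]
      constructor <;> simp only [hv] <;> linarith [h1.1, h1.2]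
  obtain ⟨f, hf0, hf⟩ := global_sol v _ _ hvlip hvb (1, β)
  have hx : ∀ t, HasDerivAt (fun t => (f t).1) (c (f t).2) t := fun t => (hf t).fst
  have hy : ∀ t, HasDerivAt (fun t => (f t).2) (2 * α / max (f t).1 ε - c (f t).2) t :=
    fun t => (hf t).snd
  have hycont : Continuous (fun t => (f t).2) :=
    continuous_iff_continuousAt.2 fun t => (hy t).continuousAt
  have hxcont : Continuous (fun t => (f t).1) :=
    continuous_iff_continuousAt.2 fun t => (hx t).continuousAt
  have hεα : 0 < 2 * α / ε := by positivity
  have hyu : ∀ t, 0 ≤ t → (f t).2 ≤ M := by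
    intro T hT
    refine image_le_of_deriv_right_lt_deriv_boundary (f := fun t => (f t).2) (a := 0) (b := T)
      (B := fun _ => M) (B' := fun _ => 0) hycont.continuousOn
      (fun t _ => (hy t).hasDerivWithinAt) ?_ (fun t => hasDerivAt_const t M) ?_ ⟨hT, le_rfl⟩
    · simp only [hf0]; linarith [le_abs_self β]
    · intro t _ h
      have : c (f t).2 = M := by
        have h : (f t).2 = M := h
        simp only [hc, h, min_self]
        exact max_eq_left (by linarith)
      simp only [this]
      linarith [hgle (f t).1, abs_nonneg β]
  have hyl : ∀ t, 0 ≤ t → -(f t).2 ≤ M := by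
    intro T hT
    refine image_le_of_deriv_right_lt_deriv_boundary (f := fun t => -(f t).2) (a := 0) (b := T)
      (B := fun _ => M) (B' := fun _ => 0) hycont.neg.continuousOn
      (fun t _ => (hy t).neg.hasDerivWithinAt) ?_ (fun t => hasDerivAt_const t M) ?_ ⟨hT, le_rfl⟩
    · simp only [hf0]; linarith [neg_abs_le β]
    · intro t _ h
      have : c (f t).2 = -M := by
        have h' : (f t).2 = -M := by have h : -(f t).2 = M := h; linarith
        simp only [hc, h']
        rw [min_eq_left (by linarith), max_self]
      simp only [this]
      linarith [hgpos (f t).1]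
  have hcy : ∀ t, 0 ≤ t → c (f t).2 = (f t).2 := by
    intro t ht
    simp only [hc]
    rw [min_eq_left (hyu t ht), max_eq_left (by linarith [hyl t ht])]
  -- energy
  have hicont : Continuous (fun s : ℝ => 1 / max s ε) := by
    apply Continuous.div continuous_const (by fun_prop)
    intro s
    exact (lt_of_lt_of_le hε0 (le_max_right _ _)).ne'
  set F : ℝ → ℝ := fun x => ∫ s in ε..x, 1 / max s ε with hF
  have hFd : ∀ x, HasDerivAt F (1 / max x ε) x := fun x =>
    (hicont.integral_hasStrictDerivAt ε x).hasDerivAt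
  have hF1 : F 1 = β ^ 2 / (4 * α) := by
    have : F 1 = ∫ s in ε..1, 1 / s := by
      apply intervalIntegral.integral_congr
      intro s hs
      rw [uIcc_of_le hε1] at hs
      simp only [max_eq_left hs.1]
    rw [this, integral_one_div_of_pos hε0 one_pos, one_div, Real.log_inv, hε, Real.log_exp, neg_neg]
  have hFneg : ∀ x < ε, F x < 0 := by
    intro x hx
    have : F x = ∫ s in ε..x, 1 / ε := by
      apply intervalIntegral.integral_congr
      intro s hs
      rw [uIcc_of_ge hx.le] at hs
      simp only [max_eq_right hs.2]
    rw [this, intervalIntegral.integral_const, smul_eq_mul]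
    exact mul_neg_of_neg_of_pos (by linarith) (by positivity)
  have hE : ∀ t, HasDerivAt (fun t => (f t).2 ^ 2 / 2 - 2 * α * F (f t).1)
      ((f t).2 * (2 * α / max (f t).1 ε - c (f t).2)
        - 2 * α * (1 / max (f t).1 ε * c (f t).2)) t := by
    intro t
    have h1 := ((hy t).pow 2).div_const 2
    have h2 := ((hFd (f t).1).comp t (hx t)).const_mul (2 * α)
    convert! h1.sub h2 using 1
    simp; ring
  have hanti : AntitoneOn (fun t => (f t).2 ^ 2 / 2 - 2 * α * F (f t).1) (Ici 0) := by
    apply antitoneOn_of_deriv_nonpos (convex_Ici 0)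
    · exact fun t _ => (hE t).continuousAt.continuousWithinAt
    · exact fun t _ => (hE t).differentiableAt.differentiableWithinAt
    · intro t ht
      rw [interior_Ici] at ht
      rw [(hE t).deriv, hcy t (le_of_lt ht)]
      have : (f t).2 * (2 * α / max (f t).1 ε - (f t).2)
        - 2 * α * (1 / max (f t).1 ε * (f t).2) = -(f t).2 ^ 2 := by ring
      rw [this]
      nlinarith [sq_nonneg (f t).2]
  have hlow : ∀ t, 0 ≤ t → ε ≤ (f t).1 := by
    intro t ht
    by_contra hlt
    have h1 := hFneg _ (not_le.1 hlt)
    have h2 := hanti (mem_Ici.2 le_rfl) (mem_Ici.2 ht) ht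
    simp only [hf0, hF1] at h2
    have h3 : 2 * α * (β ^ 2 / (4 * α)) = β ^ 2 / 2 := by field_simp; ring
    have h4 : 2 * α * F (f t).1 < 0 := mul_neg_of_pos_of_neg (by positivity) h1
    nlinarith [sq_nonneg (f t).2]
  refine ⟨fun t => (f t).1, fun t => (f t).2, ε, hε0, by simp [hf0], by simp [hf0], hlow, ?_, ?_⟩
  · intro t ht
    have := hx t
    rwa [hcy t ht] at this
  · intro t ht
    have := hy t
    rwa [hcy t ht, max_eq_left (hlow t ht)] at this

lemma smooth_system (α : ℝ) (x y : ℝ → ℝ) (hpos : ∀ t, 0 ≤ t → 0 < x t)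
    (hx : ∀ t, 0 ≤ t → HasDerivWithinAt x (y t) (Ici 0) t)
    (hy : ∀ t, 0 ≤ t → HasDerivWithinAt y (2 * α / x t - y t) (Ici 0) t) :
    ContDiffOn ℝ (⊤ : ℕ∞) x (Ici 0) := by
  have hu : UniqueDiffOn ℝ (Ici (0:ℝ)) := uniqueDiffOn_Ici 0
  have hn : ∀ n : ℕ, ContDiffOn ℝ n x (Ici 0) ∧ ContDiffOn ℝ n y (Ici 0) := by
    intro n
    induction n with
    | zero =>
      constructor
      · exact contDiffOn_zero.2 fun t ht => (hx t ht).continuousWithinAt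
      · exact contDiffOn_zero.2 fun t ht => (hy t ht).continuousWithinAt
    | succ n ih =>
      push_cast
      rw [contDiffOn_succ_iff_derivWithin hu, contDiffOn_succ_iff_derivWithin hu]
      refine ⟨⟨fun t ht => (hx t ht).differentiableWithinAt, by simp, ?_⟩,
        ⟨fun t ht => (hy t ht).differentiableWithinAt, by simp, ?_⟩⟩
      · exact ih.2.congr fun t ht => (hx t ht).derivWithin (hu t ht)
      · refine ContDiffOn.congr (f := fun t => 2 * α / x t - y t) ?_
          fun t ht => (hy t ht).derivWithin (hu t ht)
        exact (contDiffOn_const.div ih.1 fun t ht => (hpos t ht).ne').sub ih.2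
  exact contDiffOn_infty.2 fun n => (hn n).1

lemma unique_system (α : ℝ) (hα : 0 < α) (x y z w : ℝ → ℝ)
    (hpx : ∀ t, 0 ≤ t → 0 < x t) (hpz : ∀ t, 0 ≤ t → 0 < z t)
    (hx : ∀ t, 0 ≤ t → HasDerivWithinAt x (y t) (Ici 0) t)
    (hy : ∀ t, 0 ≤ t → HasDerivWithinAt y (2 * α / x t - y t) (Ici 0) t)
    (hz : ∀ t, 0 ≤ t → HasDerivWithinAt z (w t) (Ici 0) t)
    (hw : ∀ t, 0 ≤ t → HasDerivWithinAt w (2 * α / z t - w t) (Ici 0) t)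
    (h0 : x 0 = z 0) (h1 : y 0 = w 0) : EqOn x z (Ici 0) := by
  intro T hT
  have hT : (0:ℝ) ≤ T := hT
  have low : ∀ u : ℝ → ℝ, (∀ t, 0 ≤ t → 0 < u t) → ContinuousOn u (Ici 0) →
      ∃ m > 0, ∀ t ∈ Icc 0 T, m ≤ u t := by
    intro u hu huc
    obtain ⟨t₀, ht₀, h⟩ := isCompact_Icc.exists_isMinOn (nonempty_Icc.2 hT)
      (huc.mono Icc_subset_Ici_self)
    exact ⟨u t₀, hu _ ht₀.1, fun t ht => h ht⟩
  obtain ⟨m₁, hm₁, hb₁⟩ := low x hpx fun t ht => (hx t ht).continuousWithinAt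
  obtain ⟨m₂, hm₂, hb₂⟩ := low z hpz fun t ht => (hz t ht).continuousWithinAt
  set m := min m₁ m₂
  have hm : 0 < m := lt_min hm₁ hm₂
  have hvlip := (LipschitzWith.prod_snd (α := ℝ) (β := ℝ)).prodMk
    (((lip_div_max (2 * α) m (by positivity) hm).comp LipschitzWith.prod_fst).sub
      (LipschitzWith.prod_snd (α := ℝ) (β := ℝ)))
  have aux : ∀ p q : ℝ → ℝ, (∀ t ∈ Icc 0 T, m ≤ p t) →
      (∀ t, 0 ≤ t → HasDerivWithinAt p (q t) (Ici 0) t) →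
      (∀ t, 0 ≤ t → HasDerivWithinAt q (2 * α / p t - q t) (Ici 0) t) →
      ContinuousOn (fun t => (p t, q t)) (Icc 0 T) ∧
      ∀ t ∈ Ico 0 T, HasDerivWithinAt (fun t => (p t, q t))
        (q t, 2 * α / max (p t) m - q t) (Ici t) t := by
    intro p q hb hp hq
    constructor
    · intro t ht
      exact ((hp t ht.1).continuousWithinAt.prodMk (hq t ht.1).continuousWithinAt).mono
        Icc_subset_Ici_self
    · intro t ht
      rw [max_eq_left (hb t ⟨ht.1, ht.2.le⟩)]
      exact ((hp t ht.1).prodMk (hq t ht.1)).mono (Ici_subset_Ici.2 ht.1)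
  obtain ⟨c1, d1⟩ := aux x y (fun t ht => (min_le_left _ _).trans (hb₁ t ht)) hx hy
  obtain ⟨c2, d2⟩ := aux z w (fun t ht => (min_le_right _ _).trans (hb₂ t ht)) hz hw
  have := ODE_solution_unique (v := fun _ (p : ℝ × ℝ) => (p.2, 2 * α / max p.1 m - p.2))
    (fun _ => hvlip) c1 d1 c2 d2 (by simp [h0, h1]) (⟨hT, le_rfl⟩ : T ∈ Icc 0 T)
  exact congrArg Prod.fst this


/-- For every `α₀ > 0` and `β₀ ∈ ℝ` there exists a unique global solution
`τ ∈ C^∞([0,∞))` of `τ̈ = 2α₀/τ − τ̇` with `τ(0) = 1`, `τ̇(0) = β₀`, taking values in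
`(0,∞)`; moreover this solution is uniformly bounded from below by a strictly positive
constant.  Derivatives are taken within `[0,∞)`, and uniqueness is up to equality on
`[0,∞)`. -/
theorem tau_existence_uniqueness (α₀ β₀ : ℝ) (hα₀ : 0 < α₀) :
    ∃ τ : ℝ → ℝ,
      (ContDiffOn ℝ (⊤ : ℕ∞) τ (Set.Ici 0) ∧
        (∀ t ∈ Set.Ici (0:ℝ), 0 < τ t) ∧
        τ 0 = 1 ∧
        derivWithin τ (Set.Ici 0) 0 = β₀ ∧
        (∀ t ∈ Set.Ici (0:ℝ),
          derivWithin (derivWithin τ (Set.Ici 0)) (Set.Ici 0) t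
            = 2 * α₀ / τ t - derivWithin τ (Set.Ici 0) t) ∧
        (∃ ε > (0:ℝ), ∀ t ∈ Set.Ici (0:ℝ), ε ≤ τ t)) ∧
      ∀ σ : ℝ → ℝ,
        ContDiffOn ℝ (⊤ : ℕ∞) σ (Set.Ici 0) →
        (∀ t ∈ Set.Ici (0:ℝ), 0 < σ t) →
        σ 0 = 1 →
        derivWithin σ (Set.Ici 0) 0 = β₀ →
        (∀ t ∈ Set.Ici (0:ℝ),
          derivWithin (derivWithin σ (Set.Ici 0)) (Set.Ici 0) t
            = 2 * α₀ / σ t - derivWithin σ (Set.Ici 0) t) →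
        Set.EqOn σ τ (Set.Ici 0) := by
  obtain ⟨x, y, ε, hε, hx0, hy0, hlow, hx, hy⟩ := exists_system α₀ β₀ hα₀
  have hu : UniqueDiffOn ℝ (Ici (0:ℝ)) := uniqueDiffOn_Ici 0
  have hx' : ∀ t, 0 ≤ t → HasDerivWithinAt x (y t) (Ici 0) t :=
    fun t ht => (hx t ht).hasDerivWithinAt
  have hy' : ∀ t, 0 ≤ t → HasDerivWithinAt y (2 * α₀ / x t - y t) (Ici 0) t :=
    fun t ht => (hy t ht).hasDerivWithinAt
  have hpos : ∀ t, 0 ≤ t → 0 < x t := fun t ht => hε.trans_le (hlow t ht)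
  have hdx : EqOn (derivWithin x (Ici 0)) y (Ici 0) :=
    fun t ht => (hx' t ht).derivWithin (hu t ht)
  refine ⟨x, ⟨smooth_system α₀ x y hpos hx' hy', hpos, hx0, ?_, ?_, ε, hε, hlow⟩, ?_⟩
  · rw [hdx (mem_Ici.2 le_rfl), hy0]
  · intro t ht
    rw [derivWithin_congr hdx (hdx ht), hdx ht]
    exact (hy' t ht).derivWithin (hu t ht)
  · intro σ hσ hσp hσ0 hσ1 hode
    have hd : ∀ t, 0 ≤ t → HasDerivWithinAt σ (derivWithin σ (Ici 0) t) (Ici 0) t :=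
      fun t ht => (hσ.differentiableOn (by simp) t ht).hasDerivWithinAt
    have hσ' : ContDiffOn ℝ 1 (derivWithin σ (Ici 0)) (Ici 0) :=
      hσ.derivWithin hu (WithTop.coe_le_coe.2 (le_top : (1 + 1 : ℕ∞) ≤ ⊤))
    have hd2 : ∀ t, 0 ≤ t → HasDerivWithinAt (derivWithin σ (Ici 0))
        (2 * α₀ / σ t - derivWithin σ (Ici 0) t) (Ici 0) t := by
      intro t ht
      rw [← hode t ht]
      exact (hσ'.differentiableOn (by simp) t ht).hasDerivWithinAt
    exact unique_system α₀ hα₀ σ _ x y hσp hpos hd hd2 hx' hy' (by rw [hσ0, hx0])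
      (by rw [hσ1, hy0])
end

section
/- The unique global positive solution τ of τ̈ = 2α₀/τ − τ̇, τ(0) = 1, τ̇(0) = β₀ satisfies the asymptotics τ(t)/√t → 2√α₀ and √t · τ̇(t) → √α₀ as t → ∞. Moreover, in the case α₀ = 1 and β₀ = 0, the function t ↦ τ(t) − 2√t is bounded on [0,∞). -/
open Real Filter Topology Set

lemma anti_aux (f f' : ℝ → ℝ) (T : ℝ) (h : ∀ t ≥ T, HasDerivAt f (f' t) t)
    (hn : ∀ t ≥ T, f' t ≤ 0) : ∀ t ≥ T, f t ≤ f T := by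
  have : AntitoneOn f (Ici T) := by
    apply antitoneOn_of_hasDerivWithinAt_nonpos (f' := f') (convex_Ici T)
    · intro t ht
      exact (h t ht).continuousAt.continuousWithinAt
    · intro t ht
      rw [interior_Ici] at ht
      exact (h t (le_of_lt ht)).hasDerivWithinAt
    · intro t ht
      rw [interior_Ici] at ht
      exact hn t (le_of_lt ht)
  intro t ht
  exact this (mem_Ici.2 le_rfl) ht ht

lemma up_aux (f g : ℝ → ℝ) (h : ∀ t > 0, HasDerivAt f (g t - f t) t) (M ε : ℝ) (hε : 0 < ε)
    (hg : ∀ᶠ t in atTop, g t ≤ M) : ∀ᶠ t in atTop, f t ≤ M + ε := by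
  obtain ⟨T, hT⟩ := eventually_atTop.1 (hg.and (eventually_gt_atTop (0:ℝ)))
  have key := anti_aux (fun t => exp t * (f t - M))
    (fun t => exp t * (f t - M) + exp t * (g t - f t)) T
    (fun t ht => (Real.hasDerivAt_exp t).mul ((h t (hT t ht).2).sub_const M))
    (fun t ht => by
      have := (hT t ht).1
      have h2 := Real.exp_pos t
      nlinarith)
  have hlim : Tendsto (fun t => exp (-t) * (exp T * (f T - M))) atTop (𝓝 0) := by
    simpa using (Real.tendsto_exp_neg_atTop_nhds_zero).mul_const (exp T * (f T - M))
  filter_upwards [hlim.eventually_lt_const hε, eventually_ge_atTop T] with t h1 h2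
  have h3 := key t h2
  have h4 : f t - M = exp (-t) * (exp t * (f t - M)) := by
    rw [← mul_assoc, ← Real.exp_add]; simp
  have h5 := mul_le_mul_of_nonneg_left h3 (Real.exp_pos (-t)).le
  linarith

lemma low_aux (f g : ℝ → ℝ) (h : ∀ t > 0, HasDerivAt f (g t - f t) t) (M ε : ℝ) (hε : 0 < ε)
    (hg : ∀ᶠ t in atTop, M ≤ g t) : ∀ᶠ t in atTop, M - ε ≤ f t := by
  have := up_aux (fun t => - f t) (fun t => - g t)
    (fun t ht => by
      have := (h t ht).neg
      exact this.congr_deriv (by ring)) (-M) ε hε (hg.mono fun t ht => by linarith)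
  filter_upwards [this] with t ht
  linarith

lemma lim_aux (f g : ℝ → ℝ) (h : ∀ t > 0, HasDerivAt f (g t - f t) t) (L : ℝ)
    (hg : Tendsto g atTop (𝓝 L)) : Tendsto f atTop (𝓝 L) := by
  rw [tendsto_order]
  constructor
  · intro a ha
    have h1 := low_aux f g h (L - (L - a)/3) ((L-a)/3) (by linarith)
      (hg.eventually_const_le (by linarith))
    filter_upwards [h1] with t ht
    linarith
  · intro a ha
    have h1 := up_aux f g h (L + (a - L)/3) ((a-L)/3) (by linarith)
      (hg.eventually_le_const (by linarith))
    filter_upwards [h1] with t ht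
    linarith

lemma div_up (f f' : ℝ → ℝ) (h : ∀ t > 0, HasDerivAt f (f' t) t) (M ε : ℝ) (hε : 0 < ε)
    (hg : ∀ᶠ t in atTop, f' t ≤ M) : ∀ᶠ t in atTop, f t / t ≤ M + ε := by
  obtain ⟨T, hT⟩ := eventually_atTop.1 (hg.and (eventually_gt_atTop (0:ℝ)))
  have key := anti_aux (fun t => f t - M * t) (fun t => f' t - M * 1) T
    (fun t ht => (h t (hT t ht).2).sub ((hasDerivAt_id t).const_mul M))
    (fun t ht => by
      have := (hT t ht).1
      linarith)
  filter_upwards [eventually_ge_atTop T, eventually_gt_atTop 0,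
    eventually_ge_atTop ((f T - M * T) / ε)] with t h1 h2 h3
  have := key t h1
  rw [div_le_iff₀ hε] at h3
  rw [div_le_iff₀ h2]
  linarith

lemma div_lim (f f' : ℝ → ℝ) (h : ∀ t > 0, HasDerivAt f (f' t) t) (L : ℝ)
    (hg : Tendsto f' atTop (𝓝 L)) : Tendsto (fun t => f t / t) atTop (𝓝 L) := by
  rw [tendsto_order]
  constructor
  · intro a ha
    have h1 := div_up (fun t => - f t) (fun t => - f' t) (fun t ht => (h t ht).neg)
      (-(L - (L - a)/3)) ((L-a)/3) (by linarith)
      ((hg.eventually_const_le (show L - (L - a)/3 < L by linarith)).mono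
        fun t ht => by linarith)
    filter_upwards [h1] with t ht
    rw [neg_div] at ht
    linarith
  · intro a ha
    have h1 := div_up f f' h (L + (a - L)/3) ((a-L)/3) (by linarith)
      (hg.eventually_le_const (by linarith))
    filter_upwards [h1] with t ht
    linarith

/-- The unique global positive solution `τ` of `τ̈ = 2α₀/τ − τ̇`, `τ(0) = 1`,
`τ̇(0) = β₀` satisfies `τ(t)/√t → 2√α₀` and `√t · τ̇(t) → √α₀` as `t → ∞`; moreover, if
`α₀ = 1` and `β₀ = 0`, then `t ↦ τ(t) − 2√t` is bounded on `[0,∞)`. -/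
theorem tau_asymptotics (α₀ β₀ : ℝ) (hα₀ : 0 < α₀)
    (τ τ' : ℝ → ℝ)
    (hτpos : ∀ t ≥ (0:ℝ), 0 < τ t)
    (hτC2 : ∀ t ≥ (0:ℝ), HasDerivWithinAt τ (τ' t) (Set.Ici 0) t)
    (hτode : ∀ t ≥ (0:ℝ), HasDerivWithinAt τ' (2 * α₀ / τ t - τ' t) (Set.Ici 0) t)
    (hτ0 : τ 0 = 1) (hτ'0 : τ' 0 = β₀) :
    Tendsto (fun t => τ t / Real.sqrt t) atTop (𝓝 (2 * Real.sqrt α₀)) ∧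
      Tendsto (fun t => Real.sqrt t * τ' t) atTop (𝓝 (Real.sqrt α₀)) ∧
      (α₀ = 1 → β₀ = 0 → ∃ C : ℝ, ∀ t ≥ (0:ℝ), |τ t - 2 * Real.sqrt t| ≤ C) := by
  have d1 : ∀ t > 0, HasDerivAt τ (τ' t) t := fun t ht =>
    (hτC2 t (le_of_lt ht)).hasDerivAt (Ici_mem_nhds ht)
  have d2 : ∀ t > 0, HasDerivAt τ' (2 * α₀ / τ t - τ' t) t := fun t ht =>
    (hτode t (le_of_lt ht)).hasDerivAt (Ici_mem_nhds ht)
  have dw : ∀ t > 0, HasDerivAt (fun t => τ t ^ 2) (2 * τ t * τ' t) t := fun t ht => by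
    have := (d1 t ht).pow 2
    exact this.congr_deriv (by simp)
  have dw' : ∀ t > 0, HasDerivAt (fun t => 2 * τ t * τ' t)
      ((4 * α₀ + 2 * τ' t ^ 2) - 2 * τ t * τ' t) t := fun t ht => by
    have := ((d1 t ht).const_mul 2).mul (d2 t ht)
    refine this.congr_deriv ?_
    have := (hτpos t ht.le).ne'
    field_simp
    ring
  have dF : ∀ t > 0, HasDerivAt (fun t => 2 * τ t * τ' t + τ t ^ 2 - 4 * α₀ * t)
      (2 * τ' t ^ 2) t := fun t ht => by
    have := ((dw' t ht).add (dw t ht)).sub ((hasDerivAt_id t).const_mul (4 * α₀))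
    exact this.congr_deriv (by ring)
  have Fmono : ∀ T > 0, ∀ t ≥ T, 2 * τ T * τ' T + τ T ^ 2 - 4 * α₀ * T ≤
      2 * τ t * τ' t + τ t ^ 2 - 4 * α₀ * t := by
    intro T hT t ht
    have := anti_aux (fun t => -(2 * τ t * τ' t + τ t ^ 2 - 4 * α₀ * t))
      (fun t => -(2 * τ' t ^ 2)) T (fun t ht => (dF t (lt_of_lt_of_le hT ht)).neg)
      (fun t _ => by nlinarith [sq_nonneg (τ' t)]) t ht
    linarith
  have hwinf : Tendsto (fun t => τ t ^ 2) atTop atTop := by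
    rw [tendsto_atTop]
    intro b
    have h1 := low_aux (fun t => τ t ^ 2) (fun t => 2 * τ t * τ' t + τ t ^ 2)
      (fun t ht => by simpa using dw t ht) (b + 1) 1 one_pos (by
        filter_upwards [eventually_ge_atTop 1, eventually_ge_atTop
          ((b + 1 - (2 * τ 1 * τ' 1 + τ 1 ^ 2 - 4 * α₀ * 1)) / (4 * α₀))] with t h1 h2
        rw [div_le_iff₀ (by linarith)] at h2
        have := Fmono 1 one_pos t h1
        linarith)
    filter_upwards [h1] with t ht
    linarith
  have hτinf : Tendsto τ atTop atTop := by
    have := Real.tendsto_sqrt_atTop.comp hwinf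
    refine this.congr' ?_
    filter_upwards [eventually_ge_atTop 0] with t ht
    simp [Real.sqrt_sq (hτpos t ht).le]
  have hp : Tendsto τ' atTop (𝓝 0) :=
    lim_aux τ' (fun t => 2 * α₀ / τ t) d2 0 (hτinf.const_div_atTop _)
  have hw' : Tendsto (fun t => 2 * τ t * τ' t) atTop (𝓝 (4 * α₀)) := by
    apply lim_aux _ (fun t => 4 * α₀ + 2 * τ' t ^ 2) dw'
    simpa using ((hp.pow 2).const_mul 2).const_add (4 * α₀)
  have hwt := div_lim _ _ dw _ hw'
  have hs4 : Real.sqrt (4 * α₀) = 2 * Real.sqrt α₀ := by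
    rw [show 4 * α₀ = 2 ^ 2 * α₀ by ring, Real.sqrt_mul (by norm_num), Real.sqrt_sq (by norm_num)]
  have hA : Tendsto (fun t => τ t / Real.sqrt t) atTop (𝓝 (2 * Real.sqrt α₀)) := by
    rw [← hs4]
    refine ((Real.continuous_sqrt.tendsto _).comp hwt).congr' ?_
    filter_upwards [eventually_ge_atTop 0] with t ht
    simp [Real.sqrt_div (sq_nonneg (τ t)), Real.sqrt_sq (hτpos t ht).le]
  have hsp : 0 < Real.sqrt α₀ := Real.sqrt_pos.2 hα₀
  have hB : Tendsto (fun t => Real.sqrt t * τ' t) atTop (𝓝 (Real.sqrt α₀)) := by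
    have h := (hw'.div_const 2).div hA (by positivity)
    have e : 4 * α₀ / 2 / (2 * Real.sqrt α₀) = Real.sqrt α₀ := by
      have := Real.mul_self_sqrt hα₀.le
      field_simp
      nlinarith
    rw [e] at h
    refine h.congr' ?_
    filter_upwards [eventually_gt_atTop 0] with t ht
    have h1 := (hτpos t ht.le).ne'
    have h2 := (Real.sqrt_pos.2 ht).ne'
    simp only [Pi.div_apply]
    field_simp
  refine ⟨hA, hB, ?_⟩
  rintro rfl -
  have e1 : ∀ᶠ t in atTop, |Real.sqrt t * τ' t| < 2 :=
    hB.abs.eventually_lt_const (by simp)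
  have e2 : ∀ᶠ t in atTop, |2 * τ t * τ' t| < 5 :=
    hw'.abs.eventually_lt_const (by norm_num)
  obtain ⟨T, hT⟩ := eventually_atTop.1 ((e1.and e2).and (eventually_ge_atTop (1:ℝ)))
  have hT1 : 1 ≤ T := (hT T le_rfl).2
  set F0 := 2 * τ T * τ' T + τ T ^ 2 - 4 * 1 * T with hF0
  have hup := anti_aux (fun t => 2 * τ t * τ' t + τ t ^ 2 - 4 * 1 * t - 16 * Real.sqrt t)
    (fun t => 2 * τ' t ^ 2 - 16 * (1 / (2 * Real.sqrt t))) T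
    (fun t ht => by
      have h0 : 0 < t := by linarith
      exact (dF t h0).sub ((Real.hasDerivAt_sqrt h0.ne').const_mul 16))
    (fun t ht => by
      obtain ⟨⟨h1, -⟩, h2⟩ := hT t ht
      have hs : 1 ≤ Real.sqrt t := Real.one_le_sqrt.2 h2
      have h3 : (Real.sqrt t * τ' t) ^ 2 ≤ 4 := by
        nlinarith [abs_lt.1 h1]
      have h4 : τ' t ^ 2 * Real.sqrt t ≤ 4 := by
        have : 0 ≤ τ' t ^ 2 * Real.sqrt t := by positivity
        nlinarith
      have h5 : 16 * (1 / (2 * Real.sqrt t)) = 8 / Real.sqrt t := by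
        field_simp; norm_num
      rw [h5, sub_nonpos, le_div_iff₀ (by linarith)]
      linarith)
  have hcont : ContinuousOn (fun t => τ t - 2 * Real.sqrt t) (Icc 0 T) := by
    apply ContinuousOn.sub
    · intro t ht
      exact ((hτC2 t ht.1).continuousWithinAt).mono Icc_subset_Ici_self
    · fun_prop
  obtain ⟨C, hC⟩ := isCompact_Icc.exists_bound_of_continuousOn hcont
  refine ⟨max C (|F0| + 21), fun t ht => ?_⟩
  rcases le_total t T with h | h
  · exact le_max_of_le_left (hC t ⟨ht, h⟩)
  apply le_max_of_le_right
  obtain ⟨⟨-, h1⟩, h2⟩ := hT t h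
  have hs : 1 ≤ Real.sqrt t := Real.one_le_sqrt.2 h2
  have hsT : 0 ≤ Real.sqrt T := Real.sqrt_nonneg T
  have k1 := hup t h
  have k2 := Fmono T (by linarith) t h
  rw [← hF0] at k1 k2
  have hpos := hτpos t ht
  have hss := Real.mul_self_sqrt ht
  obtain ⟨h3, h4⟩ := abs_lt.1 h1
  have a1 := le_abs_self F0
  have a2 := neg_abs_le F0
  have a3 := abs_nonneg F0
  have b1 : (|F0| + 21) * 1 ≤ (|F0| + 21) * Real.sqrt t :=
    mul_le_mul_of_nonneg_left hs (by linarith)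
  have b2 : |F0| * 1 ≤ |F0| * Real.sqrt t := mul_le_mul_of_nonneg_left hs a3
  have hm : |τ t - 2 * Real.sqrt t| * (τ t + 2 * Real.sqrt t) ≤ (|F0| + 21) * Real.sqrt t := by
    have : |τ t - 2 * Real.sqrt t| * (τ t + 2 * Real.sqrt t) = |τ t ^ 2 - 4 * t| := by
      rw [← abs_of_pos (show 0 < τ t + 2 * Real.sqrt t by linarith), ← abs_mul]
      congr 1
      linear_combination -4 * hss
    rw [this, abs_le]
    constructor <;> linarith
  have hn := abs_nonneg (τ t - 2 * Real.sqrt t)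
  have : |τ t - 2 * Real.sqrt t| * Real.sqrt t ≤ (|F0| + 21) * Real.sqrt t := by
    refine le_trans (mul_le_mul_of_nonneg_left ?_ hn) hm
    linarith
  exact le_of_mul_le_mul_right this (by linarith)
end

section
/- Suppose I₁, I₂ : [0,∞) → ℝ are C¹ functions satisfying İ₁ = −I₁ − 2I₂ and İ₂ = I₁/τ². Then the rescaled first moment Ĩ₂(t) := τ(t) I₂(t) satisfies Ĩ₂'' = −Ĩ₂', and consequently τ(t) I₂(t) = I₂(0) + I₁(0)(1 − e^{−t}) for all t ≥ 0; in particular, √t · I₂(t) converges to (I₂(0) + I₁(0))/2 as t → ∞. -/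
open Real Filter Topology Set

theorem const_of_deriv_zero_Ici (f : ℝ → ℝ)
    (hf : ∀ t ≥ (0:ℝ), HasDerivWithinAt f 0 (Set.Ici 0) t) (t : ℝ) (ht : 0 ≤ t) :
    f t = f 0 := by
  refine constant_of_has_deriv_right_zero (a := 0) (b := t) ?_ ?_ t ⟨ht, le_rfl⟩
  · intro x hx
    exact (hf x hx.1).continuousWithinAt.mono Set.Icc_subset_Ici_self
  · intro x hx
    exact (hf x hx.1).mono (Set.Ici_subset_Ici.2 hx.1)

/-- Suppose `I₁, I₂ : [0,∞) → ℝ` are C¹ and satisfy `İ₁ = −I₁ − 2I₂`, `İ₂ = I₁/τ²`,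
where `τ` is the global positive solution of `τ̈ = 2/τ − τ̇`, `τ(0) = 1`, `τ̇(0) = 0`
(which satisfies `τ(t)/√t → 2`).  Then `Ĩ₂ := τ I₂` satisfies `Ĩ₂'' = −Ĩ₂'`, hence
`τ(t) I₂(t) = I₂(0) + I₁(0)(1 − e^{−t})` for all `t ≥ 0`; in particular
`√t · I₂(t) → (I₂(0) + I₁(0))/2` as `t → ∞`.  Derivatives are taken within `[0,∞)`. -/
theorem first_moment_evolution
    (τ τ' : ℝ → ℝ)
    (hτpos : ∀ t ≥ (0:ℝ), 0 < τ t)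
    (hτC2 : ∀ t ≥ (0:ℝ), HasDerivWithinAt τ (τ' t) (Set.Ici 0) t)
    (hτode : ∀ t ≥ (0:ℝ), HasDerivWithinAt τ' (2 / τ t - τ' t) (Set.Ici 0) t)
    (hτ0 : τ 0 = 1) (hτ'0 : τ' 0 = 0)
    (hτasymp : Tendsto (fun t => τ t / Real.sqrt t) atTop (𝓝 2))
    (I₁ I₂ : ℝ → ℝ)
    (hI₁ : ∀ t ≥ (0:ℝ), HasDerivWithinAt I₁ (-I₁ t - 2 * I₂ t) (Set.Ici 0) t)
    (hI₂ : ∀ t ≥ (0:ℝ), HasDerivWithinAt I₂ (I₁ t / τ t ^ 2) (Set.Ici 0) t) :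
    (∀ t ≥ (0:ℝ), HasDerivWithinAt (fun s => τ s * I₂ s)
        (τ' t * I₂ t + I₁ t / τ t) (Set.Ici 0) t) ∧
      (∀ t ≥ (0:ℝ), HasDerivWithinAt (fun s => τ' s * I₂ s + I₁ s / τ s)
        (-(τ' t * I₂ t + I₁ t / τ t)) (Set.Ici 0) t) ∧
      (∀ t ≥ (0:ℝ), τ t * I₂ t = I₂ 0 + I₁ 0 * (1 - Real.exp (-t))) ∧
      Tendsto (fun t => Real.sqrt t * I₂ t) atTop (𝓝 ((I₂ 0 + I₁ 0) / 2)) := by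
  have h1 : ∀ t ≥ (0:ℝ), HasDerivWithinAt (fun s => τ s * I₂ s)
        (τ' t * I₂ t + I₁ t / τ t) (Set.Ici 0) t := by
    intro t ht
    have hp := (hτpos t ht).ne'
    refine ((hτC2 t ht).mul (hI₂ t ht)).congr_deriv ?_
    field_simp
  have h2 : ∀ t ≥ (0:ℝ), HasDerivWithinAt (fun s => τ' s * I₂ s + I₁ s / τ s)
        (-(τ' t * I₂ t + I₁ t / τ t)) (Set.Ici 0) t := by
    intro t ht
    have hp := (hτpos t ht).ne'
    refine (((hτode t ht).mul (hI₂ t ht)).add ((hI₁ t ht).div (hτC2 t ht) hp)).congr_deriv ?_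
    field_simp
    ring
  have h3 : ∀ t ≥ (0:ℝ), τ t * I₂ t = I₂ 0 + I₁ 0 * (1 - Real.exp (-t)) := by
    intro t ht
    have a := const_of_deriv_zero_Ici
      (fun s => τ s * I₂ s + (τ' s * I₂ s + I₁ s / τ s))
      (fun t ht => ((h1 t ht).add (h2 t ht)).congr_deriv (by ring)) t ht
    have b := const_of_deriv_zero_Ici
      (fun s => (τ' s * I₂ s + I₁ s / τ s) * Real.exp s)
      (fun t ht => ((h2 t ht).mul (Real.hasDerivAt_exp t).hasDerivWithinAt).congr_deriv
        (by ring)) t ht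
    simp only [hτ0, hτ'0, Real.exp_zero, zero_mul, one_mul, mul_one, zero_add, div_one] at a b
    have c : τ' t * I₂ t + I₁ t / τ t = I₁ 0 * Real.exp (-t) := by
      rw [← b, mul_assoc, ← Real.exp_add]
      simp
    rw [c] at a
    linarith
  refine ⟨h1, h2, h3, ?_⟩
  have e : Tendsto (fun t : ℝ => I₂ 0 + I₁ 0 * (1 - Real.exp (-t))) atTop
      (𝓝 (I₂ 0 + I₁ 0 * (1 - 0))) :=
    ((Real.tendsto_exp_neg_atTop_nhds_zero.const_sub 1).const_mul _).const_add _
  have q := e.div hτasymp two_ne_zero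
  rw [sub_zero, mul_one] at q
  refine q.congr' ?_
  filter_upwards [eventually_gt_atTop (0:ℝ)] with t ht
  have hp := (hτpos t ht.le).ne'
  have hs := (Real.sqrt_pos.2 ht).ne'
  simp only [Pi.div_apply]
  rw [← h3 t ht.le]
  field_simp
end

section
/- For every ε with 0 < ε < 2/3 there exists a constant C_ε > 0 such that for every measurable function R : ℝ → [0,∞) with ∫_ℝ R(y) dy < ∞ and ∫_ℝ y² R(y) dy < ∞, one has the interpolation inequality ∫_ℝ R(y)^{1−ε} dy ≤ C_ε (∫_ℝ R(y) dy)^{1 − 3ε/2} (∫_ℝ y² R(y) dy)^{ε/2}. -/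
open Real Filter Topology Set MeasureTheory ENNReal

/-- For every `ε` with `0 < ε < 2/3` there is a constant `C_ε > 0` such that every
nonnegative measurable `R : ℝ → [0,∞)` with finite mass and finite second moment
satisfies the interpolation inequality
`∫ R^{1−ε} ≤ C_ε (∫ R)^{1 − 3ε/2} (∫ y² R)^{ε/2}`. -/
theorem interpolation_inequality (ε : ℝ) (hε0 : 0 < ε) (hε1 : ε < 2 / 3) :
    ∃ C : ℝ, 0 < C ∧ ∀ R : ℝ → ℝ, Measurable R → (∀ y, 0 ≤ R y) →
      (∫⁻ y : ℝ, ENNReal.ofReal (R y)) < ⊤ →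
      (∫⁻ y : ℝ, ENNReal.ofReal (y ^ 2 * R y)) < ⊤ →
      (∫⁻ y : ℝ, ENNReal.ofReal (R y ^ (1 - ε)))
        ≤ ENNReal.ofReal C * (∫⁻ y : ℝ, ENNReal.ofReal (R y)) ^ (1 - 3 * ε / 2)
            * (∫⁻ y : ℝ, ENNReal.ofReal (y ^ 2 * R y)) ^ (ε / 2) := by
  set r : ℝ := 2 * (1 - ε) / ε with hr
  have hr1 : 1 < r := by
    rw [hr, lt_div_iff₀ hε0]; linarith
  have hint : Integrable (fun x : ℝ => (1 + ‖x‖ ^ 2) ^ (-r / 2)) :=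
    integrable_rpow_neg_one_add_norm_sq (by simpa using hr1)
  set g : ℝ → ℝ := fun x => (1 + ‖x‖ ^ 2) ^ (-r / 2) with hg
  have hg0 : ∀ x, 0 ≤ g x := fun x => by simp only [hg]; positivity
  have hgm : Measurable g := by simp only [hg]; fun_prop
  set K : ℝ := ∫ x, g x with hK
  have hK0 : 0 ≤ K := integral_nonneg hg0
  refine ⟨2 ^ (1 - ε) * (K + 1) ^ ε, by positivity, ?_⟩
  intro R hRm hR0 hM hS
  by_cases hae : R =ᵐ[volume] 0
  · have : (∫⁻ y : ℝ, ENNReal.ofReal (R y ^ (1 - ε))) = 0 := by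
      rw [← lintegral_zero (μ := (volume : Measure ℝ))]
      apply lintegral_congr_ae
      filter_upwards [hae] with y hy
      rw [hy, Pi.zero_apply, Real.zero_rpow (by linarith), ENNReal.ofReal_zero]
    rw [this]; exact zero_le
  have hM0 : (∫⁻ y : ℝ, ENNReal.ofReal (R y)) ≠ 0 := by
    intro h
    rw [lintegral_eq_zero_iff (by fun_prop)] at h
    apply hae
    filter_upwards [h] with y hy
    exact le_antisymm (ENNReal.ofReal_eq_zero.1 hy) (hR0 y)
  have hS0 : (∫⁻ y : ℝ, ENNReal.ofReal (y ^ 2 * R y)) ≠ 0 := by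
    intro h
    rw [lintegral_eq_zero_iff (by fun_prop)] at h
    apply hae
    have h0 : ∀ᵐ y : ℝ, y ≠ 0 := by simp [ae_iff]
    filter_upwards [h, h0] with y hy hy0
    have h1 := ENNReal.ofReal_eq_zero.1 hy
    have h2 : 0 < y ^ 2 := by positivity
    exact le_antisymm (by by_contra hc; push Not at hc; exact absurd h1 (not_le.2 (mul_pos h2 hc))) (hR0 y)
  obtain ⟨m, hm, hMm⟩ : ∃ m : ℝ, 0 < m ∧ (∫⁻ y : ℝ, ENNReal.ofReal (R y)) = ENNReal.ofReal m :=
    ⟨_, ENNReal.toReal_pos hM0 hM.ne, (ENNReal.ofReal_toReal hM.ne).symm⟩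
  obtain ⟨s, hs, hSs⟩ : ∃ s : ℝ, 0 < s ∧
      (∫⁻ y : ℝ, ENNReal.ofReal (y ^ 2 * R y)) = ENNReal.ofReal s :=
    ⟨_, ENNReal.toReal_pos hS0 hS.ne, (ENNReal.ofReal_toReal hS.ne).symm⟩
  rw [hMm, hSs]
  set b : ℝ := (m / s) ^ (1 / 2 : ℝ) with hb
  have hb0 : 0 < b := by positivity
  have hb2 : b ^ 2 = m / s := by
    rw [hb, ← Real.sqrt_eq_rpow, Real.sq_sqrt (by positivity)]
  have h1 : (∫⁻ y : ℝ, ENNReal.ofReal (R y * (1 + ‖b * y‖ ^ 2))) = ENNReal.ofReal (2 * m) := by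
    have : ∀ y, ENNReal.ofReal (R y * (1 + ‖b * y‖ ^ 2)) =
        ENNReal.ofReal (R y) + ENNReal.ofReal (b ^ 2) * ENNReal.ofReal (y ^ 2 * R y) := by
      intro y
      rw [← ENNReal.ofReal_mul (by positivity), ← ENNReal.ofReal_add (hR0 y)
        (mul_nonneg (by positivity) (mul_nonneg (by positivity) (hR0 y)))]
      congr 1
      rw [Real.norm_eq_abs, sq_abs]; ring
    simp_rw [this]
    rw [lintegral_add_left (by fun_prop), lintegral_const_mul _ (by fun_prop), hMm, hSs,
      ← ENNReal.ofReal_mul (by positivity), ← ENNReal.ofReal_add hm.le (by positivity), hb2]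
    congr 1
    field_simp; ring
  have h2 : (∫⁻ y : ℝ, ENNReal.ofReal (g (b * y))) = ENNReal.ofReal (b⁻¹ * K) := by
    rw [← ofReal_integral_eq_lintegral_ofReal (hint.comp_mul_left' hb0.ne')
      (Eventually.of_forall fun y => hg0 _), Measure.integral_comp_mul_left g b,
      abs_of_pos (by positivity), smul_eq_mul]
  have key := ENNReal.lintegral_mul_norm_pow_le (μ := (volume : Measure ℝ))
    (f := fun y => ENNReal.ofReal (R y * (1 + ‖b * y‖ ^ 2)))
    (g := fun y => ENNReal.ofReal (g (b * y))) (p := 1 - ε) (q := ε)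
    (by fun_prop) (by fun_prop) (by linarith) (by linarith) (by ring)
  rw [h1, h2] at key
  have hl : ∀ y, ENNReal.ofReal (R y ^ (1 - ε)) =
      ENNReal.ofReal (R y * (1 + ‖b * y‖ ^ 2)) ^ (1 - ε) * ENNReal.ofReal (g (b * y)) ^ ε := by
    intro y
    have hw : 0 < 1 + ‖b * y‖ ^ 2 := by positivity
    rw [ENNReal.ofReal_rpow_of_nonneg (mul_nonneg (hR0 y) hw.le) (by linarith),
      ENNReal.ofReal_rpow_of_nonneg (hg0 _) hε0.le, ← ENNReal.ofReal_mul
        (Real.rpow_nonneg (mul_nonneg (hR0 y) hw.le) _)]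
    congr 1
    simp only [hg]
    rw [Real.mul_rpow (hR0 y) hw.le, ← Real.rpow_mul hw.le, mul_assoc, ← Real.rpow_add hw]
    have : 1 - ε + -r / 2 * ε = 0 := by rw [hr]; field_simp; ring
    rw [this, Real.rpow_zero, mul_one]
  simp_rw [hl]
  refine key.trans ?_
  rw [ENNReal.ofReal_rpow_of_nonneg (by positivity) (by linarith),
    ENNReal.ofReal_rpow_of_nonneg (by positivity) hε0.le,
    ENNReal.ofReal_rpow_of_nonneg hm.le (by linarith),
    ENNReal.ofReal_rpow_of_nonneg hs.le (by linarith),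
    ← ENNReal.ofReal_mul (by positivity), ← ENNReal.ofReal_mul (by positivity),
    ← ENNReal.ofReal_mul (by positivity)]
  apply ENNReal.ofReal_le_ofReal
  have hbe : b⁻¹ ^ ε = m ^ (-(ε / 2)) * s ^ (ε / 2) := by
    rw [hb, Real.inv_rpow (by positivity), ← Real.rpow_mul (by positivity),
      Real.div_rpow hm.le hs.le, inv_div, Real.rpow_neg hm.le,
      show 1 / 2 * ε = ε / 2 by ring, div_eq_inv_mul]
  have hme : m ^ (1 - 3 * ε / 2) = m ^ (1 - ε) * m ^ (-(ε / 2)) := by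
    rw [← Real.rpow_add hm]; congr 1; ring
  calc (2 * m) ^ (1 - ε) * (b⁻¹ * K) ^ ε
      ≤ (2 * m) ^ (1 - ε) * (b⁻¹ * (K + 1)) ^ ε := by
        gcongr; linarith
    _ = _ := by
        rw [Real.mul_rpow (by norm_num) hm.le, Real.mul_rpow (by positivity) (by positivity),
          hbe, hme]
        ring
end

section
/- Suppose J₁, J₂ : [0,∞) → ℝ are C¹ functions with J₁ bounded on [0,∞), satisfying J̇₁ = (2/τ²) J₂ and J̇₂ = −J₂ − 2J₁ + h, where h : [0,∞) → [0,∞) is continuous, bounded, and h(t) → 0 as t → ∞. Then J₁(t) → 0 as t → ∞. -/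
open Real Filter Topology Set

theorem aux_le (f f' : ℝ → ℝ) (T : ℝ) (hf : ∀ t ≥ T, HasDerivAt f (f' t) t)
    (hn : ∀ t ≥ T, f' t ≤ 0) : ∀ t ≥ T, f t ≤ f T := by
  have h : AntitoneOn f (Set.Ici T) := by
    apply antitoneOn_of_deriv_nonpos (convex_Ici T)
    · exact fun x hx => (hf x hx).continuousAt.continuousWithinAt
    · intro x hx
      rw [interior_Ici] at hx
      exact (hf x (le_of_lt hx)).differentiableAt.differentiableWithinAt
    · intro x hx
      rw [interior_Ici] at hx
      rw [(hf x (le_of_lt hx)).deriv]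
      exact hn x (le_of_lt hx)
  exact fun t ht => h (Set.mem_Ici.2 le_rfl) ht ht

theorem aux_bdd (y f : ℝ → ℝ) (T M : ℝ) (hy : ∀ t ≥ T, HasDerivAt y (-y t + f t) t)
    (hf : ∀ t ≥ T, |f t| ≤ M) : ∃ K : ℝ, ∀ t ≥ T, |y t| ≤ K := by
  have key := aux_le (fun t => Real.exp t * (y t ^ 2 - M ^ 2))
    (fun t => Real.exp t * (y t ^ 2 - M ^ 2) + Real.exp t * (2 * y t * (-y t + f t))) T
    (fun t ht => by
      have h1 := (Real.hasDerivAt_exp t).mul (((hy t ht).pow 2).sub_const (M ^ 2))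
      refine h1.congr_deriv ?_
      simp)
    (fun t ht => by
      have h2 : f t ^ 2 ≤ M ^ 2 := sq_le_sq' (abs_le.1 (hf t ht)).1 (abs_le.1 (hf t ht)).2
      rw [← mul_add]
      apply mul_nonpos_of_nonneg_of_nonpos (Real.exp_pos t).le
      nlinarith [sq_nonneg (y t - f t)])
  refine ⟨|M| + |y T|, fun t ht => ?_⟩
  have h3 := key t ht
  have h4 : Real.exp T ≤ Real.exp t := Real.exp_le_exp.2 ht
  have h5 : y t ^ 2 ≤ M ^ 2 + y T ^ 2 := by
    by_contra hc
    push Not at hc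
    have h6 : Real.exp T * (y T ^ 2 - M ^ 2) ≤ Real.exp t * y T ^ 2 := by
      nlinarith [Real.exp_pos T, sq_nonneg M, sq_nonneg (y T),
        mul_nonneg (Real.exp_pos T).le (sq_nonneg M),
        mul_le_mul_of_nonneg_right h4 (sq_nonneg (y T))]
    nlinarith [mul_pos (Real.exp_pos t) (sub_pos.2 hc)]
  apply abs_le_of_sq_le_sq _ (by positivity)
  nlinarith [sq_abs M, sq_abs (y T), mul_nonneg (abs_nonneg M) (abs_nonneg (y T))]

theorem aux_decay (w a g : ℝ → ℝ) (T₀ : ℝ)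
    (hw : ∀ t ≥ T₀, HasDerivAt w (a t * (-2 * w t + g t)) t)
    (hg : Tendsto g atTop (𝓝 0)) (ha : Tendsto (fun t => t * a t) atTop (𝓝 (1/2))) :
    Tendsto w atTop (𝓝 0) := by
  have hsq : Tendsto (fun t => w t ^ 2) atTop (𝓝 0) := by
    rw [Metric.tendsto_atTop']
    intro ε hε
    have e1 : ∀ᶠ t in atTop, g t ^ 2 < ε / 2 := by
      have : Tendsto (fun t => g t ^ 2) atTop (𝓝 0) := by simpa using hg.pow 2
      exact this.eventually_lt_const (by positivity)
    have e2 : ∀ᶠ t in atTop, t * a t < 1 := ha.eventually_lt_const (by norm_num)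
    have e3 : ∀ᶠ t in atTop, 1/3 < t * a t := ha.eventually_const_lt (by norm_num)
    obtain ⟨T, hT⟩ := eventually_atTop.1
      (e1.and (e2.and (e3.and ((eventually_ge_atTop T₀).and (eventually_gt_atTop 0)))))
    have key := aux_le (fun t => t * w t ^ 2 - ε / 2 * t)
      (fun t => w t ^ 2 + t * (2 * w t * (a t * (-2 * w t + g t))) - ε / 2) T
      (fun t ht => by
        obtain ⟨-, -, -, h0, -⟩ := hT t ht
        have h1 := ((hasDerivAt_id t).mul ((hw t h0).pow 2)).sub
          ((hasDerivAt_id t).const_mul (ε / 2))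
        refine h1.congr_deriv ?_
        simp)
      (fun t ht => by
        obtain ⟨h1, h2, h3, -, -⟩ := hT t ht
        have i1 : 0 ≤ (t * a t) * (w t - g t) ^ 2 := by positivity
        have i2 : 0 ≤ (t * a t - 1/3) * w t ^ 2 :=
          mul_nonneg (by linarith) (sq_nonneg _)
        have i3 : 0 ≤ (1 - t * a t) * g t ^ 2 := mul_nonneg (by linarith) (sq_nonneg _)
        nlinarith)
    refine ⟨max T (2 * (T * w T ^ 2) / ε), fun t ht => ?_⟩
    have ht1 : T < t := lt_of_le_of_lt (le_max_left _ _) ht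
    have ht2 : 2 * (T * w T ^ 2) / ε < t := lt_of_le_of_lt (le_max_right _ _) ht
    have h3 := key t ht1.le
    have hTp : 0 < T := (hT T le_rfl).2.2.2.2
    rw [div_lt_iff₀ hε] at ht2
    rw [Real.dist_eq, sub_zero, abs_of_nonneg (sq_nonneg _)]
    have : t * w t ^ 2 < t * ε := by nlinarith
    exact lt_of_mul_lt_mul_left this (by linarith)
  have := hsq.sqrt
  simp only [Real.sqrt_sq_eq_abs, Real.sqrt_zero] at this
  exact (tendsto_zero_iff_abs_tendsto_zero _).2 this

/-- Suppose `J₁, J₂ : [0,∞) → ℝ` are C¹, with `J₁` bounded, satisfying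
`J̇₁ = (2/τ²) J₂` and `J̇₂ = −J₂ − 2J₁ + h`, where `h ≥ 0` is continuous, bounded and
tends to `0` at infinity, and `τ` is the global positive solution of `τ̈ = 2/τ − τ̇`,
`τ(0) = 1`, `τ̇(0) = 0` (which satisfies `τ(t)/√t → 2` with `τ(t) − 2√t` bounded).
Then `J₁(t) → 0` as `t → ∞`.  Derivatives are taken within `[0,∞)`. -/
theorem second_moment_damped_system_tendsto_zero
    (τ τ' : ℝ → ℝ)
    (hτpos : ∀ t ≥ (0:ℝ), 0 < τ t)
    (hτC2 : ∀ t ≥ (0:ℝ), HasDerivWithinAt τ (τ' t) (Set.Ici 0) t)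
    (hτode : ∀ t ≥ (0:ℝ), HasDerivWithinAt τ' (2 / τ t - τ' t) (Set.Ici 0) t)
    (hτ0 : τ 0 = 1) (hτ'0 : τ' 0 = 0)
    (hτasymp : Tendsto (fun t => τ t / Real.sqrt t) atTop (𝓝 2))
    (hτbdd : ∃ C : ℝ, ∀ t ≥ (0:ℝ), |τ t - 2 * Real.sqrt t| ≤ C)
    (J₁ J₂ h : ℝ → ℝ)
    (hJ₁bdd : ∃ C : ℝ, ∀ t ≥ (0:ℝ), |J₁ t| ≤ C)
    (hJ₁ : ∀ t ≥ (0:ℝ), HasDerivWithinAt J₁ (2 / τ t ^ 2 * J₂ t) (Set.Ici 0) t)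
    (hJ₂ : ∀ t ≥ (0:ℝ), HasDerivWithinAt J₂ (-J₂ t - 2 * J₁ t + h t) (Set.Ici 0) t)
    (hhpos : ∀ t ≥ (0:ℝ), 0 ≤ h t)
    (hhcont : ContinuousOn h (Set.Ici 0))
    (hhbdd : ∃ C : ℝ, ∀ t ≥ (0:ℝ), h t ≤ C)
    (hhlim : Tendsto h atTop (𝓝 0)) :
    Tendsto J₁ atTop (𝓝 0) := by
  have toAt : ∀ {f : ℝ → ℝ} {d t : ℝ}, t ≥ 1 → HasDerivWithinAt f d (Set.Ici 0) t →
      HasDerivAt f d t := fun ht hd => hd.hasDerivAt (Ici_mem_nhds (by linarith))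
  have hτinf : Tendsto τ atTop atTop := by
    have h1 : Tendsto (fun t => τ t / Real.sqrt t * Real.sqrt t) atTop atTop :=
      hτasymp.pos_mul_atTop (by norm_num) Real.tendsto_sqrt_atTop
    refine h1.congr' ?_
    filter_upwards [eventually_gt_atTop 0] with t ht
    have := Real.sqrt_pos.2 ht
    field_simp
  have hτinv : Tendsto (fun t => (τ t)⁻¹) atTop (𝓝 0) := tendsto_inv_atTop_zero.comp hτinf
  have hta : Tendsto (fun t => t * (2 / τ t ^ 2)) atTop (𝓝 (1/2)) := by
    have h1 : Tendsto (fun t => 2 / (τ t / Real.sqrt t) ^ 2) atTop (𝓝 (2 / 2 ^ 2)) :=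
      tendsto_const_nhds.div (hτasymp.pow 2) (by norm_num)
    have h2 : (2:ℝ) / 2 ^ 2 = 1 / 2 := by norm_num
    rw [h2] at h1
    refine h1.congr' ?_
    filter_upwards [eventually_gt_atTop 0] with t ht
    have h3 := hτpos t ht.le
    rw [div_pow, Real.sq_sqrt ht.le]
    field_simp
  have ha0 : Tendsto (fun t => 2 / τ t ^ 2) atTop (𝓝 0) := by
    have := (hτinv.pow 2).const_mul 2
    simpa [div_eq_mul_inv] using this
  obtain ⟨C₁, hC₁⟩ := hJ₁bdd
  obtain ⟨C₂, hC₂⟩ := hhbdd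
  obtain ⟨K, hK⟩ := aux_bdd J₂ (fun t => -2 * J₁ t + h t) 1 (2 * C₁ + C₂)
    (fun t ht => (toAt ht (hJ₂ t (by linarith))).congr_deriv (by ring))
    (fun t ht => by
      have ht0 : t ≥ 0 := by linarith
      have h1 := abs_le.1 (hC₁ t ht0)
      have h2 := hC₂ t ht0
      have h3 := hhpos t ht0
      rw [abs_le]
      constructor <;> linarith [h1.1, h1.2])
  obtain ⟨S, hS⟩ := eventually_atTop.1
    ((hτinf.eventually_ge_atTop 2).and (eventually_ge_atTop 1))
  obtain ⟨L, hL⟩ := aux_bdd τ' (fun t => 2 / τ t) S 1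
    (fun t ht => (toAt (hS t ht).2 (hτode t (by linarith [(hS t ht).2]))).congr_deriv (by ring))
    (fun t ht => by
      have h1 := (hS t ht).1
      have h2 : 0 < τ t := by linarith
      rw [abs_of_nonneg (by positivity), div_le_one h2]
      exact h1)
  have bJ : IsBoundedUnder (· ≤ ·) atTop (fun t => ‖J₂ t‖) :=
    ⟨K, eventually_map.2 ((eventually_ge_atTop 1).mono fun t ht => hK t ht)⟩
  have bτ : IsBoundedUnder (· ≤ ·) atTop (fun t => ‖τ' t‖) :=
    ⟨L, eventually_map.2 ((eventually_ge_atTop S).mono fun t ht => hL t ht)⟩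
  have haJ : Tendsto (fun t => 2 / τ t ^ 2 * J₂ t) atTop (𝓝 0) :=
    ha0.zero_mul_isBoundedUnder_le bJ
  have hτJ : Tendsto (fun t => (τ t)⁻¹ * τ' t * J₂ t) atTop (𝓝 0) :=
    (hτinv.zero_mul_isBoundedUnder_le bτ).zero_mul_isBoundedUnder_le bJ
  have hw := aux_decay (fun t => J₁ t + 2 / τ t ^ 2 * J₂ t) (fun t => 2 / τ t ^ 2)
    (fun t => h t + 2 * (2 / τ t ^ 2 * J₂ t) - 2 * ((τ t)⁻¹ * τ' t * J₂ t)) 1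
    (fun t ht => by
      have ht0 : t ≥ 0 := by linarith
      have hp := hτpos t ht0
      have d1 := toAt ht (hJ₁ t ht0)
      have d2 := toAt ht (hJ₂ t ht0)
      have d3 := toAt ht (hτC2 t ht0)
      have d4 := d1.add ((((hasDerivAt_const t (2:ℝ)).div (d3.pow 2) (pow_ne_zero 2 hp.ne'))).mul d2)
      refine d4.congr_deriv ?_
      simp
      field_simp
      ring)
    (by simpa using (hhlim.add (haJ.const_mul 2)).sub (hτJ.const_mul 2))
    hta
  simpa using hw.sub haJ
end
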